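/- arXiv:0910.0641 — 4 statements merged into one kernel-verified Lean document; each statement's English description precedes it below -/
import Mathlib

section
/- For every integer d ≥ 3 and every ε > 0, there exists n₀ such that for all n ≥ n₀, Rej_{d,d+1}(S_{d+1,n}) ≤ 1/2 − 2^{−7} + ε. -/
open scoped Classical

noncomputable section

/-- `f : 𝔽₂ⁿ → 𝔽₂` has degree at most `d` (as a multilinear polynomial). -/
def degLE (n d : ℕ) (f : (Fin n → ZMod 2) → ZMod 2) : Prop :=
  ∃ p : MvPolynomial (Fin n) (ZMod 2), p.totalDegree ≤ d ∧ ∀ x, MvPolynomial.eval x p = f x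

/-- fractional Hamming distance between two functions on 𝔽₂ⁿ. -/
def hdist (n : ℕ) (f g : (Fin n → ZMod 2) → ZMod 2) : ℝ :=
  ((Finset.univ.filter fun x => f x ≠ g x).card : ℝ) / 2 ^ n

/-- distance of `f` to the Reed–Muller code RM(d,n). -/
def deltaD (n d : ℕ) (f : (Fin n → ZMod 2) → ZMod 2) : ℝ :=
  sInf {r : ℝ | ∃ g, degLE n d g ∧ r = hdist n f g}

/-- Rejection probability of the `k`-flat test: a uniformly random `k`-flat is chosen
(via a uniformly random injective affine parametrization `u ↦ M u + b`), and the test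
rejects iff the restriction of `f` does not have degree at most `d`. -/
def Rej (n d k : ℕ) (f : (Fin n → ZMod 2) → ZMod 2) : ℝ :=
  ((Finset.univ.filter fun Mb : Matrix (Fin n) (Fin k) (ZMod 2) × (Fin n → ZMod 2) =>
      Function.Injective Mb.1.mulVec ∧
        ¬ degLE k d (fun u => f (Mb.1.mulVec u + Mb.2))).card : ℝ) /
  ((Finset.univ.filter fun Mb : Matrix (Fin n) (Fin k) (ZMod 2) × (Fin n → ZMod 2) =>
      Function.Injective Mb.1.mulVec).card : ℝ)

/-- Rejection probability of the (d+1)-fold derivative (Gowers norm) test. -/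
def Rej0 (n d : ℕ) (f : (Fin n → ZMod 2) → ZMod 2) : ℝ :=
  ((Finset.univ.filter fun xa : (Fin n → ZMod 2) × (Fin (d+1) → Fin n → ZMod 2) =>
      (∑ S : Finset (Fin (d+1)), f (xa.1 + ∑ i ∈ S, xa.2 i)) = 1).card : ℝ) /
  ((2 ^ n) * (2 ^ n) ^ (d+1) : ℝ)

/-- the (d+1)-st Gowers norm of `f`. -/
def gowersNorm (n d : ℕ) (f : (Fin n → ZMod 2) → ZMod 2) : ℝ :=
  (1 - 2 * Rej0 n d f) ^ ((1 : ℝ) / 2 ^ (d+1))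

/-- t-fold XOR of `f`, as a function on 𝔽₂^(t·n). -/
def xorPow (n t : ℕ) (f : (Fin n → ZMod 2) → ZMod 2) :
    (Fin (t * n) → ZMod 2) → ZMod 2 :=
  fun x => ∑ i : Fin t, f fun j => x (finProdFinEquiv (i, j))

/-- elementary symmetric polynomial of degree m on n variables over 𝔽₂. -/
def symPoly (n m : ℕ) : (Fin n → ZMod 2) → ZMod 2 :=
  fun x => ∑ I ∈ Finset.powersetCard m Finset.univ, ∏ i ∈ I, x i

/-- the hyperplane `{x : L·x = b}`. -/
def hyp (n : ℕ) (L : Fin n → ZMod 2) (b : ZMod 2) : Set (Fin n → ZMod 2) :=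
  {x | ∑ i, L i * x i = b}



/-- The sum of all maximal minors of the `n × m` matrix with columns `a j`, over `𝔽₂`. -/
def minorSum {n m : ℕ} (a : Fin m → Fin n → ZMod 2) : ZMod 2 :=
  ∑ f : Fin m ↪ Fin n, ∏ j, a j (f j)

theorem minorSum_update_add {n m : ℕ} (a : Fin m → Fin n → ZMod 2) (i : Fin m)
    (x y : Fin n → ZMod 2) :
    minorSum (Function.update a i (x + y)) =
      minorSum (Function.update a i x) + minorSum (Function.update a i y) := by
  unfold minorSum
  rw [← Finset.sum_add_distrib]
  refine Finset.sum_congr rfl fun f _ => ?_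
  have h (w : Fin n → ZMod 2) : ∏ j, Function.update a i w j (f j) =
      w (f i) * ∏ j ∈ Finset.univ.erase i, a j (f j) := by
    rw [← Finset.mul_prod_erase _ _ (Finset.mem_univ i)]
    congr 1
    · simp
    · exact Finset.prod_congr rfl fun j hj => by
        rw [Function.update_of_ne (Finset.ne_of_mem_erase hj)]
  simp only [h, Pi.add_apply, add_mul]

theorem ZMod.mul_self_two (x : ZMod 2) : x * x = x := by
  revert x; decide

theorem ZMod.units_smul_two (s : ℤˣ) (x : ZMod 2) : s • x = x := by
  rcases Int.units_eq_one_or s with rfl | rfl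
  · simp
  · simp [Units.smul_def]

theorem det_eq_sum_prod_zmod_two {m : ℕ} (A : Matrix (Fin m) (Fin m) (ZMod 2)) :
    A.det = ∑ τ : Equiv.Perm (Fin m), ∏ j, A (τ j) j := by
  rw [Matrix.det_apply]
  exact Finset.sum_congr rfl fun τ _ => ZMod.units_smul_two _ _

/-- Over `𝔽₂`, the Gram determinant equals the sum of the maximal minors. -/
theorem det_gram_eq_minorSum {n m : ℕ} (a : Fin m → Fin n → ZMod 2) :
    (Matrix.of fun i j => a i ⬝ᵥ a j).det = minorSum a := by
  let t (f : Fin m → Fin n) (τ : Equiv.Perm (Fin m)) : ZMod 2 :=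
    ∏ j, a (τ j) (f j) * a j (f j)
  have h1 : (Matrix.of fun i j => a i ⬝ᵥ a j).det =
      ∑ f : Fin m → Fin n, ∑ τ : Equiv.Perm (Fin m), t f τ := by
    rw [det_eq_sum_prod_zmod_two, Finset.sum_comm]
    refine Finset.sum_congr rfl fun τ _ => ?_
    simp only [Matrix.of_apply, dotProduct, t]
    rw [Finset.prod_univ_sum, Fintype.piFinset_univ]
  have h2 (f : Fin m → Fin n) (hf : ¬ Function.Injective f) :
      ∑ τ : Equiv.Perm (Fin m), t f τ = 0 := by
    have hdet : (Matrix.of fun i j => a i (f j)).det = 0 := by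
      simp only [Function.Injective, not_forall] at hf
      obtain ⟨i, j, hij, hne⟩ := hf
      exact Matrix.det_zero_of_column_eq hne fun k => by simp [hij]
    simp only [t, Finset.prod_mul_distrib]
    rw [← Finset.sum_mul]
    rw [det_eq_sum_prod_zmod_two] at hdet
    simp only [Matrix.of_apply] at hdet
    rw [hdet, zero_mul]
  have h3 : ∑ f : Fin m → Fin n, ∑ τ : Equiv.Perm (Fin m), t f τ =
      ∑ f : Fin m ↪ Fin n, ∑ τ : Equiv.Perm (Fin m), t f τ := by
    symm
    refine Finset.sum_of_injOn (fun f : Fin m ↪ Fin n => (f : Fin m → Fin n))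
      (fun f _ g _ h => DFunLike.coe_injective h) (fun _ _ => by simp) ?_ (fun _ _ => rfl)
    intro f _ hf
    refine h2 f fun hinj => hf ⟨⟨f, hinj⟩, by simp, rfl⟩
  have h4 : ∑ p ∈ (Finset.univ : Finset (Fin m ↪ Fin n)) ×ˢ
      (Finset.univ.erase (1 : Equiv.Perm (Fin m))), t p.1 p.2 = 0 := by
    have key (p : (Fin m ↪ Fin n) × Equiv.Perm (Fin m)) :
        t p.1 p.2 = t (p.2⁻¹.toEmbedding.trans p.1) p.2⁻¹ := by
      simp only [t]
      rw [← Equiv.prod_comp p.2⁻¹]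
      exact Finset.prod_congr rfl fun j _ => by simp [mul_comm]
    refine Finset.sum_involution
      (fun p _ => (p.2⁻¹.toEmbedding.trans p.1, p.2⁻¹)) ?_ ?_ ?_ ?_
    · intro p _
      rw [← key]
      exact CharTwo.add_self_eq_zero _
    · intro p hp _ h
      have hp2 : p.2 ≠ 1 := by simpa using hp
      apply hp2
      have h' := congrArg Prod.fst h
      ext1 j
      have h'' := DFunLike.congr_fun h' (p.2 j)
      simpa using h''.symm
    · intro p hp
      simpa using hp
    · intro p _
      ext <;> simp
  rw [h1, h3]
  have h5 (f : Fin m ↪ Fin n) : ∑ τ : Equiv.Perm (Fin m), t f τ =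
      ∏ j, a j (f j) + ∑ τ ∈ Finset.univ.erase (1 : Equiv.Perm (Fin m)), t f τ := by
    rw [← Finset.add_sum_erase _ _ (Finset.mem_univ (1 : Equiv.Perm (Fin m)))]
    simp [t, ZMod.mul_self_two]
  simp only [h5, Finset.sum_add_distrib]
  rw [← Finset.sum_product', h4, add_zero]
  rfl

theorem minorSum_eq_zero_iff {n m : ℕ} (a : Fin m → Fin n → ZMod 2) :
    minorSum a = 0 ↔ ∃ z : Fin m → ZMod 2, z ≠ 0 ∧ ∀ i, a i ⬝ᵥ (∑ j, z j • a j) = 0 := by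
  rw [← det_gram_eq_minorSum, ← Matrix.exists_mulVec_eq_zero_iff]
  refine exists_congr fun z => and_congr_right fun _ => ?_
  rw [funext_iff]
  refine forall_congr' fun i => ?_
  simp only [Matrix.mulVec, dotProduct_sum, dotProduct_smul, smul_eq_mul, Matrix.of_apply,
    Pi.zero_apply]
  rw [dotProduct]
  simp only [mul_comm]

theorem sum_fin_succ_pi {V : Type*} [Fintype V] {k : ℕ} (F : (Fin (k + 1) → V) → ℕ) :
    ∑ b, F b = ∑ a : Fin k → V, ∑ x, F (Fin.cons x a) := by
  rw [← Equiv.sum_comp (Fin.consEquiv fun _ => V), Fintype.sum_prod_type, Finset.sum_comm]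
  rfl

theorem card_filter_fin_succ {V : Type*} [Fintype V] {k : ℕ} (P : (Fin (k + 1) → V) → Prop)
    [DecidablePred P] :
    (Finset.univ.filter P).card =
      ∑ a : Fin k → V, (Finset.univ.filter fun x => P (Fin.cons x a)).card := by
  simp only [Finset.card_filter]
  exact sum_fin_succ_pi _

theorem ZMod.eq_one_of_ne_zero_two {x : ZMod 2} (h : x ≠ 0) : x = 1 := by
  revert x; decide

theorem two_mul_card_eq_one_le {G : Type*} [AddGroup G] [Fintype G] (φ : G → ZMod 2)
    (h : ∀ x y, φ (x + y) = φ x + φ y) :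
    2 * (Finset.univ.filter fun x => φ x = 1).card ≤ Fintype.card G := by
  have hle : (Finset.univ.filter fun x => φ x = 1).card ≤
      (Finset.univ.filter fun x => ¬ φ x = 1).card := by
    by_cases hv : ∃ v, φ v = 1
    · obtain ⟨v, hv⟩ := hv
      refine Finset.card_le_card_of_injOn (fun x => x + v) ?_ (fun x _ y _ hxy => by simpa using hxy)
      intro x hx
      have hx' : φ x = 1 := by simpa using hx
      simp [h, hx', hv]
    · push Not at hv
      simp [hv]
  have := Finset.card_filter_add_card_filter_not (s := (Finset.univ : Finset G)) (fun x => φ x = 1)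
  rw [Finset.card_univ] at this
  omega

theorem card_le_four_mul_card_common_zeros {G : Type*} [AddGroup G] [Fintype G]
    (p q : G → ZMod 2) (hp : ∀ x y, p (x + y) = p x + p y) (hq : ∀ x y, q (x + y) = q x + q y) :
    Fintype.card G ≤ 4 * (Finset.univ.filter fun x => p x = 0 ∧ q x = 0).card := by
  have h := Finset.card_le_mul_card_image_of_maps_to
    (s := (Finset.univ : Finset G)) (t := (Finset.univ : Finset (ZMod 2 × ZMod 2)))
    (f := fun x => (p x, q x)) (fun _ _ => Finset.mem_univ _)
    (Finset.univ.filter fun x => p x = 0 ∧ q x = 0).card ?_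
  · have hc : (Finset.univ : Finset (ZMod 2 × ZMod 2)).card = 4 := rfl
    rw [hc, Finset.card_univ] at h
    omega
  · intro c _
    by_cases hv : ∃ v, (p v, q v) = c
    · obtain ⟨v, rfl⟩ := hv
      refine Finset.card_le_card_of_injOn (fun x => x + v) ?_ (fun x _ y _ hxy => by simpa using hxy)
      intro x hx
      simp only [Finset.coe_filter, Finset.mem_univ, true_and, Prod.mk.injEq,
        Set.mem_ofPred_eq] at hx
      simp [hp, hq, hx.1, hx.2, CharTwo.add_self_eq_zero]
    · push Not at hv
      simp [hv]

theorem card_pairs_le {G : Type*} [AddGroup G] [Fintype G] (β : G → G → ZMod 2)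
    (hβ : ∀ x y z, β x (y + z) = β x y + β x z) :
    2 * ∑ x, (Finset.univ.filter fun y => β x y = 1).card ≤ Fintype.card G ^ 2 := by
  rw [Finset.mul_sum, sq, ← smul_eq_mul, ← Finset.card_univ, ← Finset.sum_const]
  exact Finset.sum_le_sum fun x _ => two_mul_card_eq_one_le (β x) (hβ x)

theorem card_pairs_le_of_rank_le_two {G : Type*} [AddGroup G] [Fintype G] (β : G → G → ZMod 2)
    (hβ : ∀ x y z, β x (y + z) = β x y + β x z)
    (p q : G → ZMod 2) (hp : ∀ x y, p (x + y) = p x + p y) (hq : ∀ x y, q (x + y) = q x + q y)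
    (h0 : ∀ x, p x = 0 → q x = 0 → ∀ y, β x y = 0) :
    8 * ∑ x, (Finset.univ.filter fun y => β x y = 1).card ≤ 3 * Fintype.card G ^ 2 := by
  set N := Fintype.card G with hN
  set K := (Finset.univ.filter fun x => p x = 0 ∧ q x = 0).card with hK
  have hKN : N ≤ 4 * K := card_le_four_mul_card_common_zeros p q hp hq
  have hcard : K + (Finset.univ.filter fun x => ¬ (p x = 0 ∧ q x = 0)).card = N := by
    rw [hK, Finset.card_filter_add_card_filter_not, Finset.card_univ]
  have h : 2 * ∑ x, (Finset.univ.filter fun y => β x y = 1).card ≤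
      (Finset.univ.filter fun x => ¬ (p x = 0 ∧ q x = 0)).card * N := by
    rw [Finset.mul_sum, Finset.card_filter, Finset.sum_mul]
    refine Finset.sum_le_sum fun x _ => ?_
    by_cases hx : p x = 0 ∧ q x = 0
    · simp [h0 x hx.1 hx.2]
    · simpa [hx] using two_mul_card_eq_one_le (β x) (hβ x)
  nlinarith

theorem minorSum_cons_add {n k : ℕ} (a : Fin k → Fin n → ZMod 2) (x y : Fin n → ZMod 2) :
    minorSum (Fin.cons (x + y) a : Fin (k + 1) → Fin n → ZMod 2) =
      minorSum (Fin.cons x a : Fin (k + 1) → Fin n → ZMod 2) +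
        minorSum (Fin.cons y a : Fin (k + 1) → Fin n → ZMod 2) := by
  have h := minorSum_update_add (Fin.cons 0 a : Fin (k + 1) → Fin n → ZMod 2) 0 x y
  rwa [Fin.update_cons_zero, Fin.update_cons_zero, Fin.update_cons_zero] at h

/-- If the minor sum of `a` vanishes, the bilinear form obtained by adjoining two columns to `a`
has rank at most two. -/
theorem exists_additive_pair_of_minorSum_eq_zero {n k : ℕ} (a : Fin k → Fin n → ZMod 2)
    (ha : minorSum a = 0) :
    ∃ p q : (Fin n → ZMod 2) → ZMod 2,
      (∀ x y, p (x + y) = p x + p y) ∧ (∀ x y, q (x + y) = q x + q y) ∧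
      ∀ x, p x = 0 → q x = 0 → ∀ y,
        minorSum (Fin.cons y (Fin.cons x a : Fin (k + 1) → _) : Fin (k + 2) → Fin n → ZMod 2)
          = 0 := by
  obtain ⟨z, hz, hw⟩ := (minorSum_eq_zero_iff a).1 ha
  obtain ⟨i, hi⟩ := Function.ne_iff.1 hz
  have hi1 : z i = 1 := (ZMod.eq_one_of_ne_zero_two hi)
  set w := ∑ j, z j • a j with hwdef
  refine ⟨fun x => x ⬝ᵥ w, fun x => minorSum (Function.update a i x),
    fun x y => add_dotProduct _ _ _, fun x y => minorSum_update_add a i x y, ?_⟩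
  intro x hxw hq y
  replace hxw : x ⬝ᵥ w = 0 := hxw
  obtain ⟨c, hc, hv⟩ := (minorSum_eq_zero_iff _).1 hq
  have hupd : ∑ j, c j • Function.update a i x j =
      c i • x + ∑ j, Function.update c i 0 j • a j := by
    rw [← Finset.add_sum_erase _ _ (Finset.mem_univ i),
      ← Finset.add_sum_erase _ (fun j => Function.update c i 0 j • a j) (Finset.mem_univ i)]
    simp only [Function.update_self, zero_smul, zero_add]
    congr 1
    refine Finset.sum_congr rfl fun j hj => ?_
    rw [Function.update_of_ne (Finset.ne_of_mem_erase hj),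
      Function.update_of_ne (Finset.ne_of_mem_erase hj)]
  set v := ∑ j, c j • Function.update a i x j
  have hxv : x ⬝ᵥ v = 0 := by simpa using hv i
  have hjv (j : Fin k) (hj : j ≠ i) : a j ⬝ᵥ v = 0 := by simpa [hj] using hv j
  have hwv : w ⬝ᵥ v = 0 := by
    have hwa (j : Fin k) : w ⬝ᵥ a j = 0 := by rw [dotProduct_comm]; exact hw j
    rw [hupd, dotProduct_add, dotProduct_smul, dotProduct_comm, hxw, dotProduct_sum]
    simp [dotProduct_smul, hwa]
  have hiv : a i ⬝ᵥ v = 0 := by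
    have : w ⬝ᵥ v = a i ⬝ᵥ v := by
      rw [hwdef, sum_dotProduct, Finset.sum_eq_single i]
      · simp [hi1]
      · intro j _ hj
        simp [smul_dotProduct, hjv j hj]
      · simp
    rw [← this, hwv]
  have hav (j : Fin k) : a j ⬝ᵥ v = 0 := by
    by_cases hj : j = i
    · rw [hj, hiv]
    · exact hjv j hj
  have key (r s : ZMod 2) (hrs : y ⬝ᵥ (r • w + s • v) = 0)
      (hne : s * c i ≠ 0 ∨ r • z + s • Function.update c i 0 ≠ 0) :
      minorSum (Fin.cons y (Fin.cons x a : Fin (k + 1) → _) : Fin (k + 2) → Fin n → ZMod 2)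
          = 0 := by
    rw [minorSum_eq_zero_iff]
    refine ⟨Fin.cons 0
      (Fin.cons (s * c i) (r • z + s • Function.update c i 0) : Fin (k + 1) → ZMod 2), ?_, ?_⟩
    · intro h
      rcases hne with h1 | h1
      · exact h1 (by simpa using congrFun h (Fin.succ 0))
      · apply h1
        funext j
        simpa using congrFun h j.succ.succ
    · have hsum : ∑ j, (Fin.cons 0 (Fin.cons (s * c i) (r • z + s • Function.update c i 0) :
          Fin (k + 1) → ZMod 2) : Fin (k + 2) → ZMod 2) j •
          (Fin.cons y (Fin.cons x a : Fin (k + 1) → _) : Fin (k + 2) → Fin n → ZMod 2) j =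
          r • w + s • v := by
        rw [hupd, hwdef, Fin.sum_univ_succ, Fin.sum_univ_succ]
        simp only [Fin.cons_zero, Fin.cons_succ, zero_smul, zero_add, Pi.add_apply, Pi.smul_apply,
          smul_eq_mul, add_smul, mul_smul, Finset.sum_add_distrib, smul_add, Finset.smul_sum]
        abel
      rw [hsum]
      intro j
      refine Fin.cases ?_ (fun j => Fin.cases ?_ (fun j => ?_) j) j
      · simpa using hrs
      · simp [dotProduct_add, dotProduct_smul, hxw, hxv]
      · simp [dotProduct_add, dotProduct_smul, hw, hav]
  by_cases hyw : y ⬝ᵥ w = 0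
  · exact key 1 0 (by simp [hyw]) (Or.inr (by simpa using hz))
  by_cases hyv : y ⬝ᵥ v = 0
  · refine key 0 1 (by simp [hyv]) ?_
    by_contra! hcon
    apply hc
    funext j
    by_cases hj : j = i
    · simpa [hj] using hcon.1
    · simpa [hj] using congrFun hcon.2 j
  · refine key 1 1 ?_ (Or.inr fun h => ?_)
    · simp only [one_smul, dotProduct_add]
      rw [ZMod.eq_one_of_ne_zero_two hyw, ZMod.eq_one_of_ne_zero_two hyv]
      rfl
    · simpa [hi1] using congrFun h i

theorem two_mul_card_minorSum_eq_one_le (n k : ℕ) :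
    2 * (Finset.univ.filter fun a : Fin (k + 1) → Fin n → ZMod 2 => minorSum a = 1).card ≤
      (2 ^ n) ^ (k + 1) := by
  rw [card_filter_fin_succ, Finset.mul_sum]
  calc _ ≤ ∑ _a : Fin k → Fin n → ZMod 2, 2 ^ n := Finset.sum_le_sum fun a _ => by
        simpa using two_mul_card_eq_one_le
          (fun x => minorSum (Fin.cons x a : Fin (k + 1) → Fin n → ZMod 2)) (minorSum_cons_add a)
    _ = _ := by simp [pow_succ]

theorem card_minorSum_eq_one_le (n k : ℕ) :
    16 * (Finset.univ.filter fun a : Fin (k + 3) → Fin n → ZMod 2 => minorSum a = 1).card ≤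
      7 * (2 ^ n) ^ (k + 3) := by
  set N := 2 ^ n with hN
  have hV : Fintype.card (Fin n → ZMod 2) = N := by simp [hN]
  have hA := two_mul_card_minorSum_eq_one_le n k
  have hsplit := Finset.card_filter_add_card_filter_not
    (s := (Finset.univ : Finset (Fin (k + 1) → Fin n → ZMod 2))) (fun a => minorSum a = 1)
  rw [Finset.card_univ, Fintype.card_fun, hV, Fintype.card_fin] at hsplit
  have hmain : 16 * (Finset.univ.filter
      fun a : Fin (k + 3) → Fin n → ZMod 2 => minorSum a = 1).card ≤
      ∑ a : Fin (k + 1) → Fin n → ZMod 2, (6 * N ^ 2 + if minorSum a = 1 then 2 * N ^ 2 else 0) := by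
    rw [card_filter_fin_succ, sum_fin_succ_pi, Finset.mul_sum]
    refine Finset.sum_le_sum fun a _ => ?_
    have hβ (x y z : Fin n → ZMod 2) := minorSum_cons_add (Fin.cons x a : Fin (k + 2) → _) y z
    by_cases ha : minorSum a = 0
    · obtain ⟨p, q, hp, hq, h0⟩ := exists_additive_pair_of_minorSum_eq_zero a ha
      have := card_pairs_le_of_rank_le_two (fun x y => minorSum
        (Fin.cons y (Fin.cons x a : Fin (k + 2) → _) : Fin (k + 3) → _)) hβ p q hp hq h0
      rw [hV] at this
      omega
    · have := card_pairs_le (fun x y => minorSum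
        (Fin.cons y (Fin.cons x a : Fin (k + 2) → _) : Fin (k + 3) → _)) hβ
      rw [hV] at this
      rw [if_pos (ZMod.eq_one_of_ne_zero_two ha)]
      omega
  rw [Finset.sum_add_distrib, Finset.sum_const, ← Finset.sum_filter, Finset.sum_const,
    Finset.card_univ, Fintype.card_fun, hV, Fintype.card_fin, smul_eq_mul, smul_eq_mul] at hmain
  have : N ^ (k + 3) = N ^ (k + 1) * N ^ 2 := by ring
  rw [this]
  rw [← hN] at hA
  have := Nat.mul_le_mul_right (N ^ 2) hA
  linarith

theorem degLE_zero (n d : ℕ) : degLE n d fun _ => 0 := ⟨0, by simp, by simp⟩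

theorem degLE.add {n d : ℕ} {f g : (Fin n → ZMod 2) → ZMod 2} (hf : degLE n d f)
    (hg : degLE n d g) : degLE n d fun u => f u + g u := by
  obtain ⟨p, hp, hpf⟩ := hf
  obtain ⟨q, hq, hqg⟩ := hg
  exact ⟨p + q, (MvPolynomial.totalDegree_add p q).trans (max_le hp hq), fun x => by
    simp [hpf, hqg]⟩

theorem degLE.const_mul {n d : ℕ} {f : (Fin n → ZMod 2) → ZMod 2} (hf : degLE n d f)
    (c : ZMod 2) : degLE n d fun u => c * f u := by
  obtain ⟨p, hp, hpf⟩ := hf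
  exact ⟨c • p, (MvPolynomial.totalDegree_smul_le c p).trans hp, fun x => by simp [hpf]⟩

theorem degLE_sum {n d : ℕ} {ι : Type*} (s : Finset ι) (f : ι → (Fin n → ZMod 2) → ZMod 2)
    (hf : ∀ i ∈ s, degLE n d (f i)) : degLE n d fun u => ∑ i ∈ s, f i u := by
  induction s using Finset.cons_induction with
  | empty => simpa using degLE_zero n d
  | cons i s hi ih =>
    simp only [Finset.sum_cons]
    exact (hf i (by simp)).add (ih fun j hj => hf j (by simp [hj]))

theorem degLE_prod {n d : ℕ} (J : Finset (Fin n)) (hJ : J.card ≤ d) :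
    degLE n d fun u => ∏ j ∈ J, u j := by
  refine ⟨∏ j ∈ J, MvPolynomial.X j, ?_, fun x => by simp⟩
  refine (MvPolynomial.totalDegree_finsetProd J _).trans ?_
  simpa [MvPolynomial.totalDegree_X] using hJ

/-- A monomial function in which some variable does not occur has degree less than the number of
variables. -/
theorem degLE_prod_option {d : ℕ} (σ : Fin (d + 1) → Option (Fin (d + 1)))
    (hσ : ∃ j, ∀ k, σ k ≠ some j) :
    degLE (d + 1) d fun u => ∏ k, (σ k).elim 1 u := by
  obtain ⟨j, hj⟩ := hσ
  have hJ : (Finset.univ.filter fun i => ∃ k, σ k = some i).card ≤ d := by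
    have : (Finset.univ.filter fun i => ∃ k, σ k = some i).card < Fintype.card (Fin (d + 1)) :=
      Finset.card_lt_univ_of_notMem (x := j) (by simpa using hj)
    simpa [Nat.lt_succ_iff] using this
  convert degLE_prod _ hJ using 2 with u
  have hext (x y : ZMod 2) (h : x = 0 ↔ y = 0) : x = y := by
    revert x y; decide
  apply hext
  simp only [Finset.prod_eq_zero_iff, Finset.mem_univ, true_and, Finset.mem_filter]
  constructor
  · rintro ⟨k, hk⟩
    cases h : σ k with
    | none => simp [h] at hk
    | some i => exact ⟨i, ⟨k, h⟩, by simpa [h] using hk⟩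
  · rintro ⟨i, ⟨k, hk⟩, hi⟩
    exact ⟨k, by simpa [hk] using hi⟩

theorem sum_perm_prod_eq_sum_embedding {n m : ℕ} (M : Matrix (Fin n) (Fin m) (ZMod 2))
    (e : Fin m ↪ Fin n) :
    ∑ τ : Equiv.Perm (Fin m), ∏ k, M (e k) (τ k) =
      ∑ f : Fin m ↪ Fin n with Finset.univ.map f = Finset.univ.map e, ∏ j, M (f j) j := by
  refine Finset.sum_bij (fun τ _ => τ⁻¹.toEmbedding.trans e) ?_ ?_ ?_ ?_
  · intro τ _
    simp [← Finset.map_map]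
  · intro τ _ τ' _ h
    rw [← inv_inj]
    ext1 j
    exact e.injective (by simpa using DFunLike.congr_fun h j)
  · intro f hf
    have hf' : Finset.univ.map f = Finset.univ.map e := by simpa using hf
    have hmem (j : Fin m) : ∃ k, e k = f j := by
      have : f j ∈ Finset.univ.map e := hf' ▸ Finset.mem_map_of_mem f (Finset.mem_univ j)
      simpa using this
    choose t ht using hmem
    have htinj : Function.Injective t := fun i j hij =>
      f.injective (by rw [← ht, ← ht, hij])
    refine ⟨(Equiv.ofBijective t (Finite.injective_iff_bijective.1 htinj))⁻¹,
      Finset.mem_univ _, ?_⟩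
    ext1 j
    simp [ht]
  · intro τ _
    symm
    rw [← Equiv.prod_comp τ]
    simp

theorem degLE_prod_affine_add {n d : ℕ} (M : Matrix (Fin n) (Fin (d + 1)) (ZMod 2))
    (b : Fin n → ZMod 2) (e : Fin (d + 1) ↪ Fin n) :
    degLE (d + 1) d fun u => ∏ i ∈ Finset.univ.map e, (M.mulVec u + b) i +
      (∑ f : Fin (d + 1) ↪ Fin n with Finset.univ.map f = Finset.univ.map e, ∏ j, M (f j) j) *
        ∏ j, u j := by
  let A (k : Fin (d + 1)) (c : Option (Fin (d + 1))) : ZMod 2 := c.elim (b (e k)) (M (e k))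
  have hexp (u : Fin (d + 1) → ZMod 2) : ∏ i ∈ Finset.univ.map e, (M.mulVec u + b) i =
      ∑ σ : Fin (d + 1) → Option (Fin (d + 1)), (∏ k, A k (σ k)) * ∏ k, (σ k).elim 1 u := by
    rw [Finset.prod_map]
    have (k : Fin (d + 1)) : (M.mulVec u + b) (e k) = ∑ c, A k c * c.elim 1 u := by
      simp [A, Fintype.sum_option, Matrix.mulVec, dotProduct, add_comm]
    simp only [this, ← Finset.prod_mul_distrib]
    rw [Finset.prod_univ_sum, Fintype.piFinset_univ]
  have hperm (u : Fin (d + 1) → ZMod 2) :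
      ∑ σ : Fin (d + 1) → Option (Fin (d + 1))
        with ¬ (∃ j, ∀ k, σ k ≠ some j), (∏ k, A k (σ k)) * ∏ k, (σ k).elim 1 u =
      ∑ τ : Equiv.Perm (Fin (d + 1)), (∏ k, M (e k) (τ k)) * ∏ j, u j := by
    symm
    refine Finset.sum_bij (fun τ _ k => some (τ k)) ?_ ?_ ?_ ?_
    · intro τ _
      simpa using fun j => ⟨τ.symm j, by simp⟩
    · intro τ _ τ' _ h
      ext1 j
      simpa using congrFun h j
    · intro σ hσ
      have hσ' : ∀ j, ∃ k, σ k = some j := by simpa using hσ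
      choose t ht using hσ'
      have htinj : Function.Injective t := fun i j hij =>
        Option.some_injective _ (by rw [← ht, ← ht, hij])
      let τ := Equiv.ofBijective t (Finite.injective_iff_bijective.1 htinj)
      refine ⟨τ⁻¹, Finset.mem_univ _, ?_⟩
      funext k
      obtain ⟨j, rfl⟩ := τ.surjective k
      exact (congrArg some (τ.symm_apply_apply j)).trans (ht j).symm
    · intro τ _
      simp [A, Equiv.prod_comp τ u]
  have hlow : degLE (d + 1) d fun u => ∑ σ : Fin (d + 1) → Option (Fin (d + 1))
      with (∃ j, ∀ k, σ k ≠ some j),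
      (∏ k, A k (σ k)) * ∏ k, (σ k).elim 1 u :=
    degLE_sum _ _ fun σ hσ => (degLE_prod_option σ (by simpa using hσ)).const_mul _
  convert hlow using 2 with u
  rw [hexp, ← Finset.sum_filter_add_sum_filter_not _ (fun σ => ∃ j, ∀ k, σ k ≠ some j), hperm,
    ← Finset.sum_mul, sum_perm_prod_eq_sum_embedding, add_assoc, CharTwo.add_self_eq_zero,
    add_zero]

/-- The restriction of the symmetric polynomial of degree `d + 1` to a `(d + 1)`-flat drops degree
when the minor sum of the direction matrix vanishes. -/
theorem degLE_symPoly_comp_of_minorSum_eq_zero {n d : ℕ}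
    (M : Matrix (Fin n) (Fin (d + 1)) (ZMod 2)) (b : Fin n → ZMod 2)
    (h : minorSum M.transpose = 0) :
    degLE (d + 1) d fun u => symPoly n (d + 1) (M.mulVec u + b) := by
  have hsum : degLE (d + 1) d fun u => ∑ I ∈ Finset.powersetCard (d + 1) Finset.univ,
      (∏ i ∈ I, (M.mulVec u + b) i +
        (∑ f : Fin (d + 1) ↪ Fin n with Finset.univ.map f = I, ∏ j, M (f j) j) * ∏ j, u j) := by
    refine degLE_sum _ _ fun I hI => ?_
    have hc : I.card = d + 1 := (Finset.mem_powersetCard.1 hI).2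
    have := degLE_prod_affine_add M b (I.orderEmbOfFin hc).toEmbedding
    have hmap : Finset.univ.map (I.orderEmbOfFin hc).toEmbedding = I := by simp
    rwa [hmap] at this
  convert hsum using 2 with u
  rw [Finset.sum_add_distrib, ← Finset.sum_mul,
    Finset.sum_fiberwise_of_maps_to (fun f _ => by simp [Finset.mem_powersetCard])]
  have h' : ∑ f : Fin (d + 1) ↪ Fin n, ∏ j, M (f j) j = 0 := h
  rw [h', zero_mul, add_zero]
  rfl

theorem card_mulVec_eq_zero_mul_le {n m : ℕ} (u : Fin m → ZMod 2) (hu : u ≠ 0) :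
    (Finset.univ.filter fun M : Matrix (Fin n) (Fin m) (ZMod 2) => M.mulVec u = 0).card * 2 ^ n ≤
      Fintype.card (Matrix (Fin n) (Fin m) (ZMod 2)) := by
  obtain ⟨j, hj⟩ := Function.ne_iff.1 hu
  have hj1 : u j = 1 := ZMod.eq_one_of_ne_zero_two hj
  have hV : (Finset.univ : Finset (Fin n → ZMod 2)).card = 2 ^ n := by simp
  rw [← hV, ← Finset.card_product, ← Finset.card_univ]
  have hcol (v : Fin n → ZMod 2) :
      (Matrix.vecMulVec v (Pi.single j 1)).mulVec u = v := by
    simp [Matrix.vecMulVec_mulVec, hj1]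
  refine Finset.card_le_card_of_injOn
    (fun p => p.1 + Matrix.vecMulVec p.2 (Pi.single j 1)) (fun _ _ => by simp) ?_
  rintro ⟨M, v⟩ hM ⟨M', v'⟩ hM' h
  simp only [Finset.coe_product, Set.mem_prod, Finset.coe_filter, Finset.mem_univ, true_and,
    Set.mem_ofPred_eq, Finset.coe_univ, Set.mem_univ, and_true] at hM hM'
  have hv : v = v' := by
    have := congrArg (fun A => A.mulVec u) h
    simpa only [Matrix.add_mulVec, hM, hM', zero_add, hcol] using this
  subst hv
  simpa using h

theorem card_not_injective_mulVec_mul_le (n m : ℕ) :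
    (Finset.univ.filter fun M : Matrix (Fin n) (Fin m) (ZMod 2) =>
      ¬ Function.Injective M.mulVec).card * 2 ^ n ≤
      2 ^ m * Fintype.card (Matrix (Fin n) (Fin m) (ZMod 2)) := by
  have hsub : (Finset.univ.filter fun M : Matrix (Fin n) (Fin m) (ZMod 2) =>
      ¬ Function.Injective M.mulVec) ⊆
      (Finset.univ.filter fun u : Fin m → ZMod 2 => u ≠ 0).biUnion fun u =>
        Finset.univ.filter fun M : Matrix (Fin n) (Fin m) (ZMod 2) => M.mulVec u = 0 := by
    intro M hM
    simp only [Finset.mem_filter, Finset.mem_univ, true_and, Function.Injective,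
      not_forall] at hM
    obtain ⟨u, v, huv, hne⟩ := hM
    simp only [Finset.mem_biUnion, Finset.mem_filter, Finset.mem_univ, true_and]
    exact ⟨u - v, sub_ne_zero.2 hne, by rw [Matrix.mulVec_sub, huv, sub_self]⟩
  calc _ ≤ (∑ u : Fin m → ZMod 2 with u ≠ 0, (Finset.univ.filter
          fun M : Matrix (Fin n) (Fin m) (ZMod 2) => M.mulVec u = 0).card) * 2 ^ n :=
        Nat.mul_le_mul_right _ ((Finset.card_le_card hsub).trans Finset.card_biUnion_le)
    _ ≤ ∑ u : Fin m → ZMod 2 with u ≠ 0,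
          Fintype.card (Matrix (Fin n) (Fin m) (ZMod 2)) := by
        rw [Finset.sum_mul]
        exact Finset.sum_le_sum fun u hu =>
          card_mulVec_eq_zero_mul_le u (Finset.mem_filter.1 hu).2
    _ ≤ _ := by
        rw [Finset.sum_const, smul_eq_mul]
        refine Nat.mul_le_mul_right _ ((Finset.card_le_univ _).trans ?_)
        simp

theorem card_filter_fst {α β : Type*} [Fintype α] [Fintype β] (P : α → Prop) [DecidablePred P] :
    (Finset.univ.filter fun p : α × β => P p.1).card =
      (Finset.univ.filter P).card * Fintype.card β := by
  rw [← Finset.card_univ, ← Finset.card_product]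
  congr 1
  ext p
  simp

theorem Rej_symPoly_le {n d : ℕ} (hd : 2 ≤ d) (hn : d + 5 ≤ n) :
    Rej n d (d + 1) (symPoly n (d + 1)) ≤ 63 / 128 := by
  set B := 2 ^ n with hB
  set D := Fintype.card (Matrix (Fin n) (Fin (d + 1)) (ZMod 2)) with hD
  set I := (Finset.univ.filter fun M : Matrix (Fin n) (Fin (d + 1)) (ZMod 2) =>
      Function.Injective M.mulVec).card with hI
  set T := (Finset.univ.filter fun M : Matrix (Fin n) (Fin (d + 1)) (ZMod 2) =>
      minorSum M.transpose = 1).card with hT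
  have hDB : D = B ^ (d + 1) := by
    rw [hD, Fintype.card_congr (Matrix.of (m := Fin n) (n := Fin (d + 1)) (α := ZMod 2)).symm]
    simp [hB, ← pow_mul, mul_comm]
  have hT16 : 16 * T ≤ 7 * D := by
    obtain ⟨k, rfl⟩ := Nat.exists_eq_add_of_le' hd
    have h := card_minorSum_eq_one_le n k
    rw [hDB]
    refine le_trans (Nat.mul_le_mul_left _ ?_) h
    refine Finset.card_le_card_of_injOn (fun M => M.transpose) ?_
      (fun _ _ _ _ h => Matrix.transpose_injective h)
    intro M hM
    exact Finset.mem_coe.2 (Finset.mem_filter.2 ⟨Finset.mem_univ _, (Finset.mem_filter.1 hM).2⟩)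
  have hI9 : 8 * D ≤ 9 * I := by
    have hnot := card_not_injective_mulVec_mul_le n (d + 1)
    have hadd := Finset.card_filter_add_card_filter_not
      (s := (Finset.univ : Finset (Matrix (Fin n) (Fin (d + 1)) (ZMod 2))))
      (fun M => Function.Injective M.mulVec)
    rw [Finset.card_univ, ← hI, ← hD] at hadd
    rw [← hD] at hnot
    have hpow : 2 ^ n = 2 ^ (d + 1) * 2 ^ (n - (d + 1)) := by
      rw [← pow_add]; congr 1; omega
    have h16 : 16 ≤ 2 ^ (n - (d + 1)) :=
      Nat.pow_le_pow_right (n := 2) (i := 4) (by norm_num) (by omega)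
    rw [hpow, mul_comm, mul_assoc] at hnot
    have hnot' := Nat.le_of_mul_le_mul_left hnot (by positivity)
    have := (Nat.mul_le_mul_right _ h16).trans hnot'
    omega
  have hDpos : 0 < D := Fintype.card_pos
  have hBpos : 0 < B := by positivity
  have hnum : (Finset.univ.filter
      fun Mb : Matrix (Fin n) (Fin (d + 1)) (ZMod 2) × (Fin n → ZMod 2) =>
      Function.Injective Mb.1.mulVec ∧
        ¬ degLE (d + 1) d (fun u => symPoly n (d + 1) (Mb.1.mulVec u + Mb.2))).card ≤ T * B := by
    have hcard : Fintype.card (Fin n → ZMod 2) = B := by simp [hB]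
    rw [hT, ← hcard, ← card_filter_fst]
    refine Finset.card_le_card fun Mb hMb => ?_
    simp only [Finset.mem_filter, Finset.mem_univ, true_and] at hMb ⊢
    exact ZMod.eq_one_of_ne_zero_two fun h0 =>
      hMb.2 (degLE_symPoly_comp_of_minorSum_eq_zero Mb.1 Mb.2 h0)
  have hden : (Finset.univ.filter
      fun Mb : Matrix (Fin n) (Fin (d + 1)) (ZMod 2) × (Fin n → ZMod 2) =>
      Function.Injective Mb.1.mulVec).card = I * B := by
    have hcard : Fintype.card (Fin n → ZMod 2) = B := by simp [hB]
    rw [hI, ← hcard, ← card_filter_fst]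
  unfold Rej
  have hIpos : 0 < I := by omega
  have hTI : 128 * T ≤ 63 * I := by omega
  rw [hden, div_le_div_iff₀ (by positivity) (by norm_num)]
  have h1 := Nat.mul_le_mul_right B hTI
  have h2 := Nat.mul_le_mul_left 128 hnum
  have h3 : 128 * (Finset.univ.filter
      fun Mb : Matrix (Fin n) (Fin (d + 1)) (ZMod 2) × (Fin n → ZMod 2) =>
      Function.Injective Mb.1.mulVec ∧
        ¬ degLE (d + 1) d (fun u => symPoly n (d + 1) (Mb.1.mulVec u + Mb.2))).card ≤
      63 * (I * B) := by linarith
  rw [mul_comm]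
  exact_mod_cast h3

theorem statement15 (d : ℕ) (hd : 3 ≤ d) :
    ∀ ε : ℝ, 0 < ε → ∃ n₀ : ℕ, ∀ n : ℕ, n₀ ≤ n →
      Rej n d (d+1) (symPoly n (d+1)) ≤ 1/2 - (2:ℝ) ^ (-7 : ℤ) + ε := by
  intro ε hε
  refine ⟨d + 5, fun n hn => ?_⟩
  have h := Rej_symPoly_le (by omega : 2 ≤ d) hn
  have h2 : (1 : ℝ) / 2 - (2 : ℝ) ^ (-7 : ℤ) = 63 / 128 := by norm_num
  linarith

end
end

section
/- Let d ≥ 0, n ≥ d+1, and let x, a₁, …, a_{d+1} ∈ F₂ⁿ. Let M ∈ F₂^{(d+1)×n} be the matrix whose i-th row is a_i. Then, in F₂, Σ_{J ⊆ [d+1]} S_{d+1,n}(x + Σ_{j∈J} a_j) = det(M·Mᵀ). In particular, this sum is independent of x, and it equals 1 if and only if M·Mᵀ is nonsingular. -/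
open scoped Classical
open Matrix

noncomputable section

section CauchyBinet

variable {R : Type*} [CommRing R]

/-- Multilinear expansion of the determinant of a product of rectangular matrices. -/
theorem det_mul_transpose_eq_sum {κ ι : Type*} [Fintype κ] [DecidableEq κ] [Fintype ι]
    (A B : Matrix κ ι R) :
    (A * Bᵀ).det = ∑ f : κ → ι, (∏ k, A k (f k)) * (B.submatrix id f).det := by
  have hprod (σ : Equiv.Perm κ) :
      ∏ k, (A * Bᵀ) k (σ k) = ∑ f : κ → ι, (∏ k, A k (f k)) * ∏ k, B (σ k) (f k) := by
    simp only [Matrix.mul_apply, Matrix.transpose_apply, Fintype.prod_sum,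
      Finset.prod_mul_distrib]
  rw [← Matrix.det_transpose, Matrix.det_apply']
  simp only [Matrix.det_apply', Matrix.transpose_apply, hprod, Finset.mul_sum,
    Matrix.submatrix_apply, id_eq]
  rw [Finset.sum_comm]
  exact Finset.sum_congr rfl fun f _ => Finset.sum_congr rfl fun σ _ => by ring

/-- The **Cauchy–Binet formula**. -/
theorem det_mul_transpose_eq_sum_powersetCard {m n : ℕ} (A B : Matrix (Fin m) (Fin n) R) :
    (A * Bᵀ).det = ∑ I : {I : Finset (Fin n) // I.card = m},
      (A.submatrix id (I.1.orderEmbOfFin I.2)).det *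
        (B.submatrix id (I.1.orderEmbOfFin I.2)).det := by
  rw [det_mul_transpose_eq_sum,
    ← Finset.sum_filter_of_ne (p := fun f : Fin m → Fin n => Function.Injective f)]
  · have hexpand (I : {I : Finset (Fin n) // I.card = m}) :
        (A.submatrix id (I.1.orderEmbOfFin I.2)).det *
          (B.submatrix id (I.1.orderEmbOfFin I.2)).det =
        ∑ σ : Equiv.Perm (Fin m), (∏ k, A k (I.1.orderEmbOfFin I.2 (σ k))) *
          (B.submatrix id (I.1.orderEmbOfFin I.2 ∘ σ)).det := by
      rw [← Matrix.det_transpose, Matrix.det_apply', Finset.sum_mul]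
      refine Finset.sum_congr rfl fun σ _ => ?_
      rw [← Function.id_comp (id : Fin m → Fin m), ← Matrix.submatrix_submatrix,
        Matrix.det_permute', Function.id_comp]
      simp only [Matrix.transpose_apply, Matrix.submatrix_apply, id_eq]
      ring
    simp only [hexpand]
    rw [← Fintype.sum_prod_type']
    symm
    refine Finset.sum_bij (fun p _ k => p.1.1.orderEmbOfFin p.1.2 (p.2 k)) ?_ ?_ ?_ ?_
    · intro p _
      exact Finset.mem_filter.mpr
        ⟨Finset.mem_univ _, (p.1.1.orderEmbOfFin p.1.2).injective.comp p.2.injective⟩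
    · rintro ⟨⟨I, hI⟩, σ⟩ _ ⟨⟨I', hI'⟩, σ'⟩ _ h
      have hrange : (I : Set (Fin n)) = I' := by
        rw [← Finset.range_orderEmbOfFin I hI, ← Finset.range_orderEmbOfFin I' hI',
          ← σ.surjective.range_comp (I.orderEmbOfFin hI),
          ← σ'.surjective.range_comp (I'.orderEmbOfFin hI')]
        exact congrArg Set.range h
      obtain rfl : I = I' := by exact_mod_cast hrange
      simp only [Prod.mk.injEq, true_and]
      ext1 k
      exact (I.orderEmbOfFin hI).injective (congrFun h k)
    · intro f hf
      have hf : Function.Injective f := by simpa using hf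
      have hI : (Finset.univ.image f).card = m := by
        simp [Finset.card_image_of_injective _ hf]
      have hmem (k : Fin m) : ∃ l, (Finset.univ.image f).orderEmbOfFin hI l = f k := by
        have : f k ∈ Set.range ((Finset.univ.image f).orderEmbOfFin hI) := by simp
        exact this
      choose g hg using hmem
      have hginj : Function.Injective g := fun k l hkl => hf (by rw [← hg, ← hg, hkl])
      exact ⟨(⟨_, hI⟩, Equiv.ofBijective g (Finite.injective_iff_bijective.mp hginj)),
        Finset.mem_univ _, funext hg⟩
    · intro p _
      rfl
  · intro f _ hne
    by_contra hf
    simp only [Function.Injective, not_forall] at hf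
    obtain ⟨k, l, hkl, hne'⟩ := hf
    refine hne ?_
    rw [Matrix.det_zero_of_column_eq hne' (by simp [hkl]), mul_zero]

end CauchyBinet

/-- In characteristic two a sum over all supersets of a proper subset vanishes. -/
theorem sum_ite_subset_eq {κ R : Type*} [Fintype κ] [DecidableEq κ] [CommRing R] [CharP R 2]
    (T : Finset κ) :
    (∑ J : Finset κ, if T ⊆ J then (1 : R) else 0) = if T = Finset.univ then 1 else 0 := by
  rw [Finset.sum_boole, show Finset.univ.filter (T ⊆ ·) = Finset.Icc T Finset.univ by ext; simp,
    Finset.card_Icc_finset (Finset.subset_univ T)]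
  split_ifs with hT
  · simp [hT]
  · have hcard : Finset.univ.card - T.card ≠ 0 :=
      Nat.sub_ne_zero_of_lt (Finset.card_lt_card (Finset.ssubset_univ_iff.mpr hT))
    rw [Nat.cast_pow, Nat.cast_ofNat, CharTwo.two_eq_zero, zero_pow hcard]

/-- In characteristic two, the full derivative of a product of as many affine forms as there are
directions is a determinant. -/
theorem sum_finset_prod_add_sum_eq_det {κ R : Type*} [Fintype κ] [DecidableEq κ] [CommRing R] [CharP R 2]
    (B : Matrix κ κ R) (y : κ → R) :
    ∑ J : Finset κ, ∏ k, (y k + ∑ j ∈ J, B j k) = B.det := by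
  let C : Option κ → κ → R := fun o k => o.elim (y k) (fun j => B j k)
  have hfactor (J : Finset κ) (k : κ) :
      y k + ∑ j ∈ J, B j k = ∑ o : Option κ, if o.toFinset ⊆ J then C o k else 0 := by
    simp [Fintype.sum_option, C, Finset.sum_ite_mem]
  have hexpand (J : Finset κ) :
      ∏ k, (y k + ∑ j ∈ J, B j k) = ∑ g : κ → Option κ,
        (∏ k, C (g k) k) * if Finset.univ.biUnion (fun k => (g k).toFinset) ⊆ J
          then 1 else 0 := by
    simp only [hfactor, Fintype.prod_sum]
    refine Finset.sum_congr rfl fun g _ => ?_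
    rw [Finset.prod_ite_zero]
    simp only [Finset.biUnion_subset, mul_ite, mul_one, mul_zero]
    congr
  simp only [hexpand]
  rw [Finset.sum_comm]
  simp only [← Finset.mul_sum, sum_ite_subset_eq]
  simp only [mul_ite, mul_one, mul_zero]
  rw [← Finset.sum_filter, Matrix.det_apply']
  symm
  refine Finset.sum_bij (fun σ _ k => some (σ k)) ?_ ?_ ?_ ?_
  · intro σ _
    simp only [Finset.mem_filter, Finset.mem_univ, true_and, Finset.eq_univ_iff_forall]
    intro j
    simpa [eq_comm] using σ.surjective j
  · intro σ _ τ _ h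
    ext1 k
    exact Option.some_injective _ (congrFun h k)
  · intro g hg
    simp only [Finset.mem_filter, Finset.mem_univ, true_and, Finset.eq_univ_iff_forall,
      Finset.mem_biUnion, Option.mem_toFinset] at hg
    choose s hs using hg
    have hsinj : Function.Injective s := fun i j hij =>
      Option.some_injective _ ((hs i).symm.trans ((congrArg g hij).trans (hs j)))
    let e := Equiv.ofBijective s (Finite.injective_iff_bijective.mp hsinj)
    refine ⟨e.symm, Finset.mem_univ _, funext fun k => ?_⟩
    exact (hs (e.symm k)).symm.trans (congrArg g (e.apply_symm_apply k))
  · intro σ _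
    rcases Int.units_eq_one_or (Equiv.Perm.sign σ) with h | h <;>
      simp [h, C, CharTwo.neg_eq]

theorem symPoly_eq_sum_orderEmbOfFin (n m : ℕ) (z : Fin n → ZMod 2) :
    symPoly n m z = ∑ I : {I : Finset (Fin n) // I.card = m},
      ∏ k, z (I.1.orderEmbOfFin I.2 k) := by
  rw [symPoly, Finset.sum_subtype (p := fun I : Finset (Fin n) => I.card = m) _ (by simp)]
  refine Finset.sum_congr rfl fun I _ => ?_
  have hmap := Finset.prod_map Finset.univ (I.1.orderEmbOfFin I.2).toEmbedding z
  rwa [Finset.map_orderEmbOfFin_univ] at hmap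

theorem statement16 (d n : ℕ) (h : d + 1 ≤ n)
    (x : Fin n → ZMod 2) (a : Fin (d+1) → Fin n → ZMod 2)
    (M : Matrix (Fin (d+1)) (Fin n) (ZMod 2)) (hM : ∀ i j, M i j = a i j) :
    (∑ J : Finset (Fin (d+1)), symPoly n (d+1) (x + ∑ j ∈ J, a j)) = (M * Mᵀ).det ∧
    ((∑ J : Finset (Fin (d+1)), symPoly n (d+1) (x + ∑ j ∈ J, a j)) = 1 ↔
      IsUnit (M * Mᵀ).det) := by
  have hsum : (∑ J : Finset (Fin (d+1)), symPoly n (d+1) (x + ∑ j ∈ J, a j)) =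
      (M * Mᵀ).det := by
    simp only [symPoly_eq_sum_orderEmbOfFin]
    rw [Finset.sum_comm, det_mul_transpose_eq_sum_powersetCard]
    refine Finset.sum_congr rfl fun I _ => ?_
    rw [← pow_two, ZMod.pow_card, ← sum_finset_prod_add_sum_eq_det _
      (fun k => x (I.1.orderEmbOfFin I.2 k))]
    simp [hM]
  refine ⟨hsum, ?_⟩
  rw [hsum, isUnit_iff_ne_zero]
  generalize (M * Mᵀ).det = c
  revert c
  decide

end
end

section
/- There is an absolute constant C such that the following holds for all integers d ≥ 0 and n ≥ d+1. Let A be a uniformly random symmetric (d+1)×(d+1) matrix over F₂, and let B = M·Mᵀ where M is chosen uniformly at random from the (d+1)×n matrices over F₂ of rank d+1. Then the total variation distance between the distributions of A and B is at most C·2^{d−n}. -/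
open scoped Classical
open Matrix

noncomputable section

/-- Tuples of pairwise orthogonal vectors which are also orthogonal to `W`. -/
def orthogonalTuples {ι : Type*} [Fintype ι] (j : ℕ) (W : Submodule (ZMod 2) (ι → ZMod 2)) :
    Finset (Fin j → ι → ZMod 2) :=
  Finset.univ.filter fun r =>
    (∀ i, ∀ w ∈ W, r i ⬝ᵥ w = 0) ∧ ∀ i l, i ≠ l → r i ⬝ᵥ r l = 0

lemma card_orthogonalTuples_succ_le {ι : Type*} [Fintype ι] (j : ℕ)
    (W : Submodule (ZMod 2) (ι → ZMod 2)) :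
    (orthogonalTuples (j + 1) W).card ≤
      ∑ v ∈ Finset.univ.filter fun v : ι → ZMod 2 => ∀ w ∈ W, v ⬝ᵥ w = 0,
        (orthogonalTuples j (W ⊔ Submodule.span (ZMod 2) {v})).card := by
  rw [← Finset.card_sigma]
  refine Finset.card_le_card_of_injOn (fun r => ⟨r 0, Fin.tail r⟩) ?_ ?_
  · intro r hr
    simp only [orthogonalTuples, Finset.coe_filter, Finset.mem_univ, true_and,
      Set.mem_ofPred_eq] at hr
    obtain ⟨hW, hr⟩ := hr
    simp only [orthogonalTuples, Finset.coe_sigma, Set.mem_sigma_iff, Finset.coe_filter,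
      Finset.mem_univ, true_and, Set.mem_ofPred_eq]
    refine ⟨hW 0, fun i w hw => ?_, fun i l hil => hr _ _ (by simpa using hil)⟩
    obtain ⟨y, hy, z, hz, rfl⟩ := Submodule.mem_sup.1 hw
    obtain ⟨c, rfl⟩ := Submodule.mem_span_singleton.1 hz
    rw [dotProduct_add, dotProduct_smul, Fin.tail, hW _ y hy, hr _ _ (Fin.succ_ne_zero i)]
    simp
  · intro r _ s _ h
    simp only [Sigma.mk.injEq, heq_eq_eq] at h
    rw [← Fin.cons_self_tail r, ← Fin.cons_self_tail s, h.1, h.2]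

lemma card_filter_mem_submodule {ι : Type*} [Fintype ι]
    (W : Submodule (ZMod 2) (ι → ZMod 2)) :
    (Finset.univ.filter fun v : ι → ZMod 2 => v ∈ W).card =
      2 ^ Module.finrank (ZMod 2) W := by
  rw [← Fintype.card_subtype]
  have h := Module.card_eq_pow_finrank (K := ZMod 2) (V := W)
  rw [ZMod.card] at h
  rw [← h]

lemma card_mul_card_orthogonal {ι : Type*} [Fintype ι]
    (W : Submodule (ZMod 2) (ι → ZMod 2)) :
    2 ^ Module.finrank (ZMod 2) W *
      (Finset.univ.filter fun v : ι → ZMod 2 => ∀ w ∈ W, v ⬝ᵥ w = 0).card =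
      2 ^ Fintype.card ι := by
  let e := dotProductEquiv (ZMod 2) ι
  have h := Subspace.finrank_add_finrank_dualAnnihilator_eq W
  have h' : Module.finrank (ZMod 2) (W.dualAnnihilator.comap e.toLinearMap) =
      Module.finrank (ZMod 2) W.dualAnnihilator := by
    exact (e.submoduleMap _).finrank_eq.trans (by
      rw [Submodule.map_comap_eq_of_surjective e.surjective])
  have h2 := card_filter_mem_submodule (W.dualAnnihilator.comap e.toLinearMap)
  have h3 : (Finset.univ.filter fun v : ι → ZMod 2 => ∀ w ∈ W, v ⬝ᵥ w = 0) =
      Finset.univ.filter fun v => v ∈ W.dualAnnihilator.comap e.toLinearMap := by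
    ext v
    simp [e, Submodule.mem_dualAnnihilator]
  rw [h3, h2, h', ← pow_add, h, Module.finrank_fintype_fun_eq_card]

lemma card_orthogonalTuples_le {ι : Type*} [Fintype ι] (j : ℕ)
    (W : Submodule (ZMod 2) (ι → ZMod 2))
    (hW : 2 * Module.finrank (ZMod 2) W + 2 * j ≤ Fintype.card ι + 2) :
    ((orthogonalTuples j W).card : ℝ) * ((2 : ℝ) ^ Module.finrank (ZMod 2) W) ^ j *
        2 ^ j.choose 2 ≤
      ((2 : ℝ) ^ Fintype.card ι) ^ j * (1 + (1 - 1 / 2 ^ j) *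
        (((2 : ℝ) ^ Module.finrank (ZMod 2) W) ^ 2 * (2 ^ j) ^ 2 / 2 ^ Fintype.card ι)) := by
  induction j generalizing W with
  | zero =>
    simp only [pow_zero, mul_one, Nat.choose_zero_succ]
    norm_num
    exact Finset.card_le_one.2 fun _ _ _ _ => Subsingleton.elim _ _
  | succ j ih =>
    set P := Finset.univ.filter fun v : ι → ZMod 2 => ∀ w ∈ W, v ⬝ᵥ w = 0
    set a : ℝ := 2 ^ Module.finrank (ZMod 2) W with ha
    set q : ℝ := 2 ^ Fintype.card ι with hq
    set b : ℝ := 2 ^ j with hb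
    set Q : ℝ := 2 ^ j.choose 2
    have ha0 : 0 < a := by positivity
    have hq0 : 0 < q := by positivity
    have hb0 : 0 < b := by positivity
    have hQ0 : 0 < Q := by positivity
    have hPc : a * P.card = q := by
      have := card_mul_card_orthogonal W
      rw [ha, hq]
      exact_mod_cast this
    set y := a ^ 2 * b ^ 2 / q with hy
    have hy0 : 0 ≤ y := by positivity
    have hy1 : y ≤ 1 := by
      rw [hy, div_le_one hq0, ha, hb, hq, ← pow_mul, ← pow_mul, ← pow_add]
      exact pow_le_pow_right₀ (by norm_num) (by omega)
    have hyq : a ^ 2 * b = q * (y / b) := by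
      rw [hy]; field_simp
    have hbase := ih W (by omega)
    have hin : ∑ v ∈ P.filter (· ∈ W),
        ((orthogonalTuples j (W ⊔ Submodule.span (ZMod 2) {v})).card : ℝ) * (a ^ j * Q) ≤
        a * (q ^ j * (1 + (1 - 1 / b) * y)) := by
      have hX : 0 ≤ q ^ j * (1 + (1 - 1 / b) * y) := le_trans (by positivity) hbase
      calc _ ≤ ∑ v ∈ P.filter (· ∈ W), q ^ j * (1 + (1 - 1 / b) * y) := by
            refine Finset.sum_le_sum fun v hv => ?_
            have hv : v ∈ W := (Finset.mem_filter.1 hv).2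
            rw [sup_eq_left.2 ((Submodule.span_singleton_le_iff_mem _ _).2 hv), ← mul_assoc]
            exact hbase
        _ = (P.filter (· ∈ W)).card * (q ^ j * (1 + (1 - 1 / b) * y)) := by
            rw [Finset.sum_const, nsmul_eq_mul]
        _ ≤ _ := by
            refine mul_le_mul_of_nonneg_right ?_ hX
            have := (Finset.card_le_card (Finset.filter_subset_filter (· ∈ W)
              (Finset.subset_univ P))).trans_eq (card_filter_mem_submodule W)
            rw [ha]
            exact_mod_cast this
    have hout : a * ∑ v ∈ P.filter (· ∉ W),
        ((orthogonalTuples j (W ⊔ Submodule.span (ZMod 2) {v})).card : ℝ) * (a ^ j * b * Q) ≤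
        q * (q ^ j * (1 + (1 - 1 / b) * (4 * y))) := by
      have hb1 : 1 / b ≤ 1 := by
        rw [div_le_one hb0]; exact one_le_pow₀ (by norm_num)
      have hX : 0 ≤ q ^ j * (1 + (1 - 1 / b) * (4 * y)) := by
        have : 0 ≤ 1 - 1 / b := by linarith
        positivity
      have hterm : ∀ v ∈ P.filter (· ∉ W),
          ((orthogonalTuples j (W ⊔ Submodule.span (ZMod 2) {v})).card : ℝ) * (a ^ j * b * Q) ≤
          q ^ j * (1 + (1 - 1 / b) * (4 * y)) := by
        intro v hv
        have hv : v ∉ W := (Finset.mem_filter.1 hv).2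
        have hf := Submodule.finrank_sup_span_singleton hv
        have := ih (W ⊔ Submodule.span (ZMod 2) {v}) (by rw [hf]; omega)
        rw [hf, pow_succ, ← ha, mul_pow, ← hb] at this
        convert this using 1
        · ring
        · rw [hy]; ring
      calc _ ≤ a * ∑ v ∈ P.filter (· ∉ W), q ^ j * (1 + (1 - 1 / b) * (4 * y)) :=
            mul_le_mul_of_nonneg_left (Finset.sum_le_sum hterm) ha0.le
        _ = a * (P.filter (· ∉ W)).card * (q ^ j * (1 + (1 - 1 / b) * (4 * y))) := by
            rw [Finset.sum_const, nsmul_eq_mul, mul_assoc]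
        _ ≤ a * P.card * (q ^ j * (1 + (1 - 1 / b) * (4 * y))) := by
            gcongr
            exact Finset.filter_subset _ _
        _ = _ := by rw [hPc]
    have hsucc : ((orthogonalTuples (j + 1) W).card : ℝ) ≤
        ∑ v ∈ P, ((orthogonalTuples j (W ⊔ Submodule.span (ZMod 2) {v})).card : ℝ) := by
      exact_mod_cast card_orthogonalTuples_succ_le j W
    rw [← Finset.sum_filter_add_sum_filter_not P (· ∈ W)] at hsucc
    rw [← Finset.sum_mul] at hin hout
    set S₁ := ∑ v ∈ P.filter (· ∈ W),
      ((orthogonalTuples j (W ⊔ Submodule.span (ZMod 2) {v})).card : ℝ)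
    set S₂ := ∑ v ∈ P.filter (· ∉ W),
      ((orthogonalTuples j (W ⊔ Submodule.span (ZMod 2) {v})).card : ℝ)
    have hchoose : (2 : ℝ) ^ (j + 1).choose 2 = b * Q := by
      rw [Nat.choose_succ_succ' j 1, Nat.choose_one_right, pow_add]
    have hyb : y / b * ((1 - 1 / b) * y) ≤ y / b := by
      refine mul_le_of_le_one_right (by positivity) ?_
      have : 0 ≤ 1 / b * y := by positivity
      nlinarith
    calc ((orthogonalTuples (j + 1) W).card : ℝ) * a ^ (j + 1) * 2 ^ (j + 1).choose 2
        ≤ (S₁ + S₂) * a ^ (j + 1) * (b * Q) := by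
          rw [hchoose]; gcongr
      _ = a * b * (S₁ * (a ^ j * Q)) + a * (S₂ * (a ^ j * b * Q)) := by ring
      _ ≤ a * b * (a * (q ^ j * (1 + (1 - 1 / b) * y))) +
          q * (q ^ j * (1 + (1 - 1 / b) * (4 * y))) := by
          gcongr
      _ = q ^ (j + 1) * (1 + 4 * y - 3 * (y / b) + y / b * ((1 - 1 / b) * y)) := by
          linear_combination (q ^ j * (1 + (1 - 1 / b) * y)) * hyq
      _ ≤ q ^ (j + 1) * (1 + 4 * y - 2 * (y / b)) := by
          gcongr; linarith
      _ = _ := by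
          rw [pow_succ (2 : ℝ) j, ← hb, hy]
          field_simp
          ring

lemma dotProduct_one_eq_dotProduct_self {ι : Type*} [Fintype ι] (v : ι → ZMod 2) :
    v ⬝ᵥ 1 = v ⬝ᵥ v := by
  refine Finset.sum_congr rfl fun i _ => ?_
  have : ∀ x : ZMod 2, x * 1 = x * x := by decide
  exact this (v i)

/-- Second moment of the number of representations `B = M * Mᵀ`. -/
lemma sum_sq_card_mul_transpose_le (k n : ℕ) (hk : 1 ≤ k) (hkn : k ≤ n) :
    (∑ B : Matrix (Fin k) (Fin k) (ZMod 2),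
      ((Finset.univ.filter fun M : Matrix (Fin k) (Fin n) (ZMod 2) =>
        M * Mᵀ = B).card : ℝ) ^ 2) * 2 ^ (k + 1).choose 2 ≤
      ((2 : ℝ) ^ (k * n)) ^ 2 * (1 + (2 * 2 ^ k / 2 ^ n) ^ 2) := by
  let W : Submodule (ZMod 2) (Fin n ⊕ Fin n → ZMod 2) := Submodule.span (ZMod 2) {1}
  have hWr : Module.finrank (ZMod 2) W = 1 := by
    refine finrank_span_singleton fun h => ?_
    exact one_ne_zero (congrFun h (Sum.inl ⟨0, by omega⟩))
  have hcount : (∑ B : Matrix (Fin k) (Fin k) (ZMod 2),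
      (Finset.univ.filter fun M : Matrix (Fin k) (Fin n) (ZMod 2) =>
        M * Mᵀ = B).card ^ 2) ≤ (orthogonalTuples k W).card := by
    simp_rw [sq, ← Finset.card_product]
    rw [← Finset.card_sigma]
    refine Finset.card_le_card_of_injOn
      (fun x => fun i => Sum.elim (x.2.1 i) (x.2.2 i)) ?_ ?_
    · rintro ⟨B, M, N⟩ h
      simp only [Finset.coe_sigma, Set.mem_sigma_iff, Finset.coe_product, Finset.coe_filter,
        Finset.mem_univ, true_and, Set.mem_prod, Set.mem_ofPred_eq, Finset.coe_univ,
        Set.mem_univ] at h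
      have horth : ∀ i l, Sum.elim (M i) (N i) ⬝ᵥ Sum.elim (M l) (N l) = 0 := by
        intro i l
        have h1 : M i ⬝ᵥ M l = B i l := by rw [← h.1]; rfl
        have h2 : N i ⬝ᵥ N l = B i l := by rw [← h.2]; rfl
        rw [sumElim_dotProduct_sumElim, h1, h2]
        exact CharTwo.add_self_eq_zero _
      simp only [orthogonalTuples, Finset.coe_filter, Finset.mem_univ, true_and,
        Set.mem_ofPred_eq]
      refine ⟨fun i w hw => ?_, fun i l _ => horth i l⟩
      obtain ⟨c, rfl⟩ := Submodule.mem_span_singleton.1 hw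
      rw [dotProduct_smul, dotProduct_one_eq_dotProduct_self, horth, smul_zero]
    · rintro ⟨B, M, N⟩ h ⟨B', M', N'⟩ h' heq
      simp only [Finset.coe_sigma, Set.mem_sigma_iff, Finset.coe_product, Finset.coe_filter,
        Finset.mem_univ, true_and, Set.mem_prod, Set.mem_ofPred_eq, Finset.coe_univ,
        Set.mem_univ] at h h'
      have hM : M = M' := by
        ext i l
        exact congrFun (congrFun heq i) (Sum.inl l)
      have hN : N = N' := by
        ext i l
        exact congrFun (congrFun heq i) (Sum.inr l)
      subst hM hN
      obtain rfl : B = B' := h.1.symm.trans h'.1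
      rfl
  have hmain := card_orthogonalTuples_le k W (by
    rw [hWr, Fintype.card_sum, Fintype.card_fin]; omega)
  rw [hWr, Fintype.card_sum, Fintype.card_fin, pow_one] at hmain
  have hchoose : (2 : ℝ) ^ (k + 1).choose 2 = 2 ^ k * 2 ^ k.choose 2 := by
    rw [Nat.choose_succ_succ' k 1, Nat.choose_one_right, pow_add]
  calc _ ≤ ((orthogonalTuples k W).card : ℝ) * 2 ^ (k + 1).choose 2 := by
        gcongr
        exact_mod_cast hcount
    _ ≤ _ := by
        rw [hchoose, ← mul_assoc]
        refine hmain.trans ?_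
        have h1 : ((2 : ℝ) ^ (n + n)) ^ k = (2 ^ (k * n)) ^ 2 := by
          rw [← pow_mul, ← pow_mul]; congr 1; ring
        rw [h1]
        gcongr
        have h2 : (2 * 2 ^ k / 2 ^ n : ℝ) ^ 2 = 2 ^ 2 * (2 ^ k) ^ 2 / 2 ^ (n + n) := by
          rw [div_pow, mul_pow, ← pow_mul 2 n 2, mul_two]
        rw [h2]
        refine mul_le_of_le_one_left (by positivity) ?_
        have : (0 : ℝ) ≤ 1 / 2 ^ k := by positivity
        linarith

lemma card_symmetric_le (k : ℕ) :
    (Finset.univ.filter fun A : Matrix (Fin k) (Fin k) (ZMod 2) => A = Aᵀ).card ≤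
      2 ^ (k + 1).choose 2 := by
  have : Fintype.card (Sym2 (Fin k) → ZMod 2) = 2 ^ (k + 1).choose 2 := by
    rw [Fintype.card_fun, ZMod.card, Sym2.card, Fintype.card_fin]
  rw [← this, ← Finset.card_univ]
  refine Finset.card_le_card_of_surjOn
    (fun f => Matrix.of fun i j => f s(i, j)) fun A hA => ?_
  have hA : A = Aᵀ := by simpa using hA
  refine ⟨Sym2.lift ⟨A, fun i j => congrFun (congrFun hA i) j⟩, by simp, ?_⟩
  ext i j
  simp

lemma card_matrix_zmod_two (k n : ℕ) :
    Fintype.card (Matrix (Fin k) (Fin n) (ZMod 2)) = 2 ^ (k * n) := by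
  rw [← Nat.card_eq_fintype_card]
  change Nat.card (Fin k → Fin n → ZMod 2) = _
  simp [mul_comm k n, pow_mul]

lemma card_vecMul_eq_zero_mul_le (k n : ℕ) (v : Fin k → ZMod 2) (hv : v ≠ 0) :
    (Finset.univ.filter fun M : Matrix (Fin k) (Fin n) (ZMod 2) => v ᵥ* M = 0).card * 2 ^ n ≤
      2 ^ (k * n) := by
  obtain ⟨i, hi⟩ := Function.ne_iff.1 hv
  have hi : v i = 1 := by
    have : ∀ x : ZMod 2, x ≠ 0 → x = 1 := by decide
    exact this _ hi
  have h1 : 2 ^ n = (Finset.univ : Finset (Fin n → ZMod 2)).card := by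
    simp [ZMod.card]
  have h2 : 2 ^ (k * n) = (Finset.univ : Finset (Matrix (Fin k) (Fin n) (ZMod 2))).card := by
    rw [Finset.card_univ, card_matrix_zmod_two]
  rw [h1, h2, ← Finset.card_product]
  have key : ∀ (M : Matrix (Fin k) (Fin n) (ZMod 2)) (w : Fin n → ZMod 2), v ᵥ* M = 0 →
      v ᵥ* (M + vecMulVec (Pi.single i 1) w) = w := by
    intro M w hM
    rw [vecMul_add, hM, zero_add, vecMul_vecMulVec, dotProduct_single, hi]
    simp
  refine Finset.card_le_card_of_injOn
    (fun x => x.1 + vecMulVec (Pi.single i 1) x.2) (fun _ _ => by simp) ?_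
  rintro ⟨M, w⟩ h ⟨M', w'⟩ h' heq
  simp only [Finset.coe_product, Finset.coe_filter, Finset.mem_univ, true_and, Set.mem_prod,
    Set.mem_ofPred_eq, Finset.coe_univ, Set.mem_univ, and_true] at h h'
  have hw : w = w' := by
    rw [← key M w h, ← key M' w' h']
    exact congrArg (v ᵥ* ·) heq
  subst hw
  simpa using heq

lemma card_rank_ne_mul_le (k n : ℕ) :
    (Finset.univ.filter fun M : Matrix (Fin k) (Fin n) (ZMod 2) => ¬ M.rank = k).card * 2 ^ n ≤
      2 ^ k * 2 ^ (k * n) := by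
  have hsub : (Finset.univ.filter fun M : Matrix (Fin k) (Fin n) (ZMod 2) => ¬ M.rank = k) ⊆
      (Finset.univ.filter fun v : Fin k → ZMod 2 => v ≠ 0).biUnion fun v =>
        Finset.univ.filter fun M : Matrix (Fin k) (Fin n) (ZMod 2) => v ᵥ* M = 0 := by
    intro M hM
    have hM : ¬ M.rank = k := by simpa using hM
    have hdep : ¬ LinearIndependent (ZMod 2) M.row := fun h => hM <| by
      simpa using h.rank_matrix
    rw [← vecMul_injective_iff] at hdep
    simp only [Finset.mem_biUnion, Finset.mem_filter, Finset.mem_univ, true_and]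
    by_contra! hcon
    refine hdep fun x y hxy => ?_
    by_contra hne
    refine hcon (x - y) (sub_ne_zero.2 hne) ?_
    rw [sub_vecMul, sub_eq_zero]
    exact hxy
  calc _ ≤ (∑ v ∈ Finset.univ.filter fun v : Fin k → ZMod 2 => v ≠ 0,
        (Finset.univ.filter fun M : Matrix (Fin k) (Fin n) (ZMod 2) => v ᵥ* M = 0).card) *
          2 ^ n := by
        gcongr
        exact (Finset.card_le_card hsub).trans Finset.card_biUnion_le
    _ = ∑ v ∈ Finset.univ.filter fun v : Fin k → ZMod 2 => v ≠ 0,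
        (Finset.univ.filter fun M : Matrix (Fin k) (Fin n) (ZMod 2) => v ᵥ* M = 0).card *
          2 ^ n := Finset.sum_mul ..
    _ ≤ ∑ v ∈ Finset.univ.filter fun v : Fin k → ZMod 2 => v ≠ 0, 2 ^ (k * n) :=
        Finset.sum_le_sum fun v hv =>
          card_vecMul_eq_zero_mul_le k n v (Finset.mem_filter.1 hv).2
    _ = (Finset.univ.filter fun v : Fin k → ZMod 2 => v ≠ 0).card * 2 ^ (k * n) := by
        rw [Finset.sum_const, smul_eq_mul]
    _ ≤ _ := by
        gcongr
        refine (Finset.card_filter_le _ _).trans ?_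
        simp [ZMod.card]

/-- Conditioning the uniform distribution on `α` on an event `p` moves the distribution of `f`
by at most twice the probability of the complement. -/
lemma sum_abs_card_fiber_div_sub_le {α β : Type*} [Fintype α] [Nonempty α] [Fintype β]
    [DecidableEq β] (f : α → β) (p : α → Prop) [DecidablePred p] :
    ∑ b : β, |((Finset.univ.filter fun a => f a = b).card : ℝ) / Fintype.card α -
        ((Finset.univ.filter fun a => p a ∧ f a = b).card : ℝ) /
          (Finset.univ.filter fun a => p a).card| ≤
      2 * ((Finset.univ.filter fun a => ¬ p a).card / Fintype.card α) := by
  set N : ℝ := (Fintype.card α : ℝ) with hN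
  set F : ℝ := ((Finset.univ.filter fun a => p a).card : ℝ) with hF
  have hN0 : 0 < N := by rw [hN]; exact_mod_cast Fintype.card_pos
  have hsum : ∑ b : β, ((Finset.univ.filter fun a => f a = b).card : ℝ) = N := by
    rw [hN, ← Finset.card_univ,
      Finset.card_eq_sum_card_fiberwise (f := f) (t := Finset.univ) (by simp)]
    push_cast
    rfl
  have hsum' : ∑ b : β, ((Finset.univ.filter fun a => p a ∧ f a = b).card : ℝ) = F := by
    rw [hF, Finset.card_eq_sum_card_fiberwise (f := f) (t := Finset.univ) (by simp)]
    push_cast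
    simp_rw [Finset.filter_filter]
  have hcompl : ((Finset.univ.filter fun a => ¬ p a).card : ℝ) = N - F := by
    have := Finset.card_filter_add_card_filter_not (s := (Finset.univ : Finset α)) p
    rw [Finset.card_univ] at this
    rw [hN, hF, ← this]
    push_cast
    ring
  have hFN : F ≤ N := by
    rw [← sub_nonneg, ← hcompl]
    positivity
  have hterm : ∀ b : β, |((Finset.univ.filter fun a => f a = b).card : ℝ) / N -
        ((Finset.univ.filter fun a => p a ∧ f a = b).card : ℝ) / F| ≤
      (((Finset.univ.filter fun a => f a = b).card : ℝ) / N -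
        ((Finset.univ.filter fun a => p a ∧ f a = b).card : ℝ) / N) +
      (((Finset.univ.filter fun a => p a ∧ f a = b).card : ℝ) / F -
        ((Finset.univ.filter fun a => p a ∧ f a = b).card : ℝ) / N) := by
    intro b
    have hle : ((Finset.univ.filter fun a => p a ∧ f a = b).card : ℝ) ≤
        (Finset.univ.filter fun a => f a = b).card := by
      refine Nat.cast_le.2 (Finset.card_le_card fun a ha => ?_)
      rw [Finset.mem_filter] at ha ⊢
      exact ⟨ha.1, ha.2.2⟩
    have hleF : ((Finset.univ.filter fun a => p a ∧ f a = b).card : ℝ) ≤ F := by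
      refine Nat.cast_le.2 (Finset.card_le_card fun a ha => ?_)
      rw [Finset.mem_filter] at ha ⊢
      exact ⟨ha.1, ha.2.1⟩
    set x : ℝ := ((Finset.univ.filter fun a => f a = b).card : ℝ)
    set y : ℝ := ((Finset.univ.filter fun a => p a ∧ f a = b).card : ℝ)
    have hy0 : 0 ≤ y := by positivity
    have h1 : y / N ≤ x / N := by gcongr
    have h2 : y / N ≤ y / F := by
      rcases hy0.eq_or_lt with h | h
      · simp [← h]
      · have : 0 < F := h.trans_le hleF
        gcongr
    rw [abs_le]
    constructor <;> linarith
  refine (Finset.sum_le_sum fun b _ => hterm b).trans ?_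
  rw [Finset.sum_add_distrib, Finset.sum_sub_distrib, Finset.sum_sub_distrib,
    ← Finset.sum_div, ← Finset.sum_div, ← Finset.sum_div, hsum, hsum', hcompl, sub_div]
  have := div_self_le_one F
  rw [div_self hN0.ne']
  linarith

lemma sum_abs_inv_card_sub_le {β : Type*} (s : Finset β) (p : β → ℝ) (ε : ℝ) (hε : 0 ≤ ε)
    (hs : s.Nonempty) (hp : ∑ b ∈ s, p b = 1)
    (hsq : s.card * ∑ b ∈ s, p b ^ 2 ≤ 1 + ε ^ 2) :
    ∑ b ∈ s, |1 / (s.card : ℝ) - p b| ≤ ε := by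
  have hs0 : (0 : ℝ) < s.card := by exact_mod_cast hs.card_pos
  refine abs_le_of_sq_le_sq' ?_ hε |>.2
  refine sq_sum_le_card_mul_sum_sq.trans ?_
  have h : ∑ b ∈ s, |1 / (s.card : ℝ) - p b| ^ 2 =
      ∑ b ∈ s, p b ^ 2 - 1 / (s.card : ℝ) := by
    calc _ = ∑ b ∈ s, ((1 / (s.card : ℝ)) ^ 2 - 2 * (1 / (s.card : ℝ)) * p b + p b ^ 2) :=
          Finset.sum_congr rfl fun b _ => by rw [sq_abs]; ring
      _ = _ := by
          rw [Finset.sum_add_distrib, Finset.sum_sub_distrib, ← Finset.mul_sum, hp,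
            Finset.sum_const, nsmul_eq_mul]
          field_simp
          ring
  rw [h, mul_sub, mul_one_div_cancel hs0.ne']
  linarith

/-- The distribution of `M * Mᵀ` for uniform `M` is close to uniform on symmetric matrices. -/
lemma sum_abs_symmetric_sub_mul_transpose_le (k n : ℕ) (hk : 1 ≤ k) (hkn : k ≤ n) :
    ∑ B : Matrix (Fin k) (Fin k) (ZMod 2),
      |((Finset.univ.filter fun A : Matrix (Fin k) (Fin k) (ZMod 2) =>
            A = Aᵀ ∧ A = B).card : ℝ) /
          ((Finset.univ.filter fun A : Matrix (Fin k) (Fin k) (ZMod 2) => A = Aᵀ).card : ℝ) -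
        ((Finset.univ.filter fun M : Matrix (Fin k) (Fin n) (ZMod 2) =>
            M * Mᵀ = B).card : ℝ) / 2 ^ (k * n)| ≤
      2 * 2 ^ k / 2 ^ n := by
  set S := Finset.univ.filter fun A : Matrix (Fin k) (Fin k) (ZMod 2) => A = Aᵀ with hS
  set c := fun B : Matrix (Fin k) (Fin k) (ZMod 2) =>
    ((Finset.univ.filter fun M : Matrix (Fin k) (Fin n) (ZMod 2) => M * Mᵀ = B).card : ℝ)
    with hc
  have hc0 : ∀ B ∉ S, c B = 0 := by
    intro B hB
    simp only [hc, Nat.cast_eq_zero, Finset.card_eq_zero, Finset.filter_eq_empty_iff,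
      Finset.mem_univ, true_implies]
    rintro M rfl
    exact hB (Finset.mem_filter.2 ⟨Finset.mem_univ _, by rw [transpose_mul, transpose_transpose]⟩)
  have hcsum : ∑ B ∈ S, c B / 2 ^ (k * n) = 1 := by
    rw [← Finset.sum_div, Finset.sum_subset (Finset.subset_univ S) fun B _ hB => hc0 B hB,
      div_eq_one_iff_eq (by positivity)]
    have h := Finset.card_eq_sum_card_fiberwise
      (f := fun M : Matrix (Fin k) (Fin n) (ZMod 2) => M * Mᵀ) (s := Finset.univ)
      (t := Finset.univ) (fun _ _ => Finset.mem_coe.2 (Finset.mem_univ _))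
    rw [Finset.card_univ, card_matrix_zmod_two] at h
    simp only [hc]
    exact_mod_cast h.symm
  rw [← Finset.sum_subset (Finset.subset_univ S)]
  · have hind : ∀ B ∈ S, ((Finset.univ.filter fun A : Matrix (Fin k) (Fin k) (ZMod 2) =>
        A = Aᵀ ∧ A = B).card : ℝ) = 1 := by
      intro B hB
      have hB : B = Bᵀ := (Finset.mem_filter.1 hB).2
      rw [Nat.cast_eq_one, Finset.card_eq_one]
      refine ⟨B, ?_⟩
      ext A
      simp only [Finset.mem_filter, Finset.mem_univ, true_and, Finset.mem_singleton]
      exact ⟨fun h => h.2, fun h => ⟨h ▸ hB, h⟩⟩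
    rw [Finset.sum_congr rfl fun B hB => by rw [hind B hB]]
    refine sum_abs_inv_card_sub_le S
      (fun B => c B / 2 ^ (k * n)) _ (by positivity)
      ⟨0, Finset.mem_filter.2 ⟨Finset.mem_univ _, transpose_zero.symm⟩⟩ hcsum ?_
    have hsq := sum_sq_card_mul_transpose_le k n hk hkn
    have hS' : (S.card : ℝ) ≤ 2 ^ (k + 1).choose 2 := by
      exact_mod_cast card_symmetric_le k
    simp only [div_pow _ ((2 : ℝ) ^ (k * n))]
    rw [← Finset.sum_div, ← mul_div_assoc, div_le_iff₀ (by positivity)]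
    calc (S.card : ℝ) * ∑ B ∈ S, c B ^ 2 ≤ 2 ^ (k + 1).choose 2 * ∑ B, c B ^ 2 := by
          refine mul_le_mul hS' ?_ (Finset.sum_nonneg fun B _ => sq_nonneg _) (by positivity)
          exact Finset.sum_le_sum_of_subset_of_nonneg (Finset.subset_univ S)
            fun B _ _ => sq_nonneg _
      _ = (∑ B, c B ^ 2) * 2 ^ (k + 1).choose 2 := mul_comm _ _
      _ ≤ _ := hsq.trans_eq (mul_comm _ _)
  · intro B _ hB
    have h0 : (Finset.univ.filter fun A : Matrix (Fin k) (Fin k) (ZMod 2) =>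
        A = Aᵀ ∧ A = B) = ∅ := by
      rw [Finset.filter_eq_empty_iff]
      rintro A - ⟨hA, rfl⟩
      exact hB (Finset.mem_filter.2 ⟨Finset.mem_univ _, hA⟩)
    have hB0 := hc0 B hB
    simp only [hc] at hB0
    rw [h0, hB0]
    simp

theorem statement17 :
    ∃ C : ℝ, 0 < C ∧ ∀ (d n : ℕ), d + 1 ≤ n →
      (1/2 : ℝ) * ∑ B : Matrix (Fin (d+1)) (Fin (d+1)) (ZMod 2),
        |((Finset.univ.filter fun A : Matrix (Fin (d+1)) (Fin (d+1)) (ZMod 2) =>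
              A = Aᵀ ∧ A = B).card : ℝ) /
            ((Finset.univ.filter fun A : Matrix (Fin (d+1)) (Fin (d+1)) (ZMod 2) =>
              A = Aᵀ).card : ℝ) -
          ((Finset.univ.filter fun M : Matrix (Fin (d+1)) (Fin n) (ZMod 2) =>
              M.rank = d + 1 ∧ M * Mᵀ = B).card : ℝ) /
            ((Finset.univ.filter fun M : Matrix (Fin (d+1)) (Fin n) (ZMod 2) =>
              M.rank = d + 1).card : ℝ)|
        ≤ C * (2:ℝ) ^ ((d:ℤ) - n) := by
  refine ⟨4, by norm_num, fun d n hdn => ?_⟩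
  have hpow : (2 : ℝ) ^ (d + 1) / 2 ^ n = 2 * (2 : ℝ) ^ ((d : ℤ) - n) := by
    rw [zpow_sub₀ (by norm_num), zpow_natCast, zpow_natCast, pow_succ]
    ring
  have hcard : (Fintype.card (Matrix (Fin (d + 1)) (Fin n) (ZMod 2)) : ℝ) =
      2 ^ ((d + 1) * n) := by
    exact_mod_cast card_matrix_zmod_two (d + 1) n
  have huniform := sum_abs_symmetric_sub_mul_transpose_le (d + 1) n (by omega) hdn
  have hrank := sum_abs_card_fiber_div_sub_le
    (fun M : Matrix (Fin (d + 1)) (Fin n) (ZMod 2) => M * Mᵀ) fun M => M.rank = d + 1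
  have hbad : ((Finset.univ.filter fun M : Matrix (Fin (d + 1)) (Fin n) (ZMod 2) =>
      ¬ M.rank = d + 1).card : ℝ) / Fintype.card (Matrix (Fin (d + 1)) (Fin n) (ZMod 2)) ≤
      2 ^ (d + 1) / 2 ^ n := by
    rw [hcard, div_le_div_iff₀ (by positivity) (by positivity)]
    exact_mod_cast card_rank_ne_mul_le (d + 1) n
  rw [hcard] at hrank hbad
  have htri := (Finset.sum_le_sum fun B _ => abs_sub_le _ _ _).trans_eq
    Finset.sum_add_distrib |>.trans (add_le_add huniform hrank)
  rw [mul_div_assoc] at htri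
  linarith

end
end

section
/- For every integer k ≥ 4, the probability that a uniformly random symmetric k×k matrix over F₂ is invertible (i.e., has rank k) is at most 1/2 − 2^{−7}. -/
open scoped Classical
open Matrix

noncomputable section

open Finset in
/-- The number of symmetric matrices over `𝔽₂` indexed by `n` that satisfy `p`. -/
def symmCount (n : Type) [Fintype n] (p : Matrix n n (ZMod 2) → Prop) : ℕ :=
  #{A : Matrix n n (ZMod 2) | A.IsSymm ∧ p A}

/-- The symmetric matrix with corner entry `a`, first row and column `v`, and remaining block `B`. -/
def bordered {n : Type} (a : ZMod 2) (v : n → ZMod 2) (B : Matrix n n (ZMod 2)) :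
    Matrix (Unit ⊕ n) (Unit ⊕ n) (ZMod 2) :=
  fromBlocks (of fun _ _ => a) (replicateRow Unit v) (replicateCol Unit v) B

/-- The matrix `A` has trivial kernel. -/
def Nonsing {n : Type} [Fintype n] (A : Matrix n n (ZMod 2)) : Prop :=
  ∀ w, A *ᵥ w = 0 → w = 0

section
variable {n m : Type} [Fintype n] [Fintype m]

lemma isUnit_det_iff_nonsing [DecidableEq n] (A : Matrix n n (ZMod 2)) :
    IsUnit A.det ↔ Nonsing A := by
  rw [isUnit_iff_ne_zero, ne_eq, ← exists_mulVec_eq_zero_iff]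
  unfold Nonsing
  grind

lemma symmCount_le_of_injective {p : Matrix n n (ZMod 2) → Prop}
    {q : Matrix m m (ZMod 2) → Prop}
    (f : Matrix n n (ZMod 2) → Matrix m m (ZMod 2)) (hf : Function.Injective f)
    (hs : ∀ A, A.IsSymm → (f A).IsSymm) (hpq : ∀ A, p A → q (f A)) :
    symmCount n p ≤ symmCount m q := by
  refine Finset.card_le_card_of_injOn f (fun A hA => ?_) hf.injOn
  simp only [Finset.coe_filter, Finset.mem_univ, true_and, Set.mem_ofPred_eq] at hA ⊢
  exact ⟨hs A hA.1, hpq A hA.2⟩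

lemma symmCount_sum (p : Matrix (Unit ⊕ n) (Unit ⊕ n) (ZMod 2) → Prop) :
    symmCount (Unit ⊕ n) p = ∑ a, ∑ v, symmCount n (fun B => p (bordered a v B)) := by
  simp only [symmCount]
  simp_rw [← Finset.sum_product', ← Finset.card_sigma]
  have key : ∀ A : Matrix (Unit ⊕ n) (Unit ⊕ n) (ZMod 2), A.IsSymm →
      bordered (A (.inl ()) (.inl ())) (fun i => A (.inl ()) (.inr i)) A.toBlocks₂₂ = A := by
    intro A hA
    ext (i | i) (j | j) <;> simp [bordered, toBlocks₂₂, hA.apply]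
  refine Finset.card_bij' (fun A _ => ⟨(A (.inl ()) (.inl ()), fun i => A (.inl ()) (.inr i)),
    A.toBlocks₂₂⟩) (fun x _ => bordered x.1.1 x.1.2 x.2) ?_ ?_ ?_ ?_
  · intro A hA
    simp only [Finset.mem_filter, Finset.mem_univ, true_and] at hA
    simp only [Finset.mem_sigma, Finset.mem_product, Finset.mem_univ, Finset.mem_filter, true_and,
      and_true, key A hA.1]
    exact ⟨IsSymm.ext fun i j => hA.1.apply _ _, hA.2⟩
  · intro x hx
    simp only [Finset.mem_sigma, Finset.mem_product, Finset.mem_univ, Finset.mem_filter, true_and,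
      and_true] at hx ⊢
    refine ⟨IsSymm.ext ?_, hx.2⟩
    rintro (i | i) (j | j) <;> simp [bordered, hx.1.apply]
  · intro A hA
    simp only [Finset.mem_filter, Finset.mem_univ, true_and] at hA
    exact key A hA.1
  · intro x hx
    simp [bordered, toBlocks₂₂]
    rfl

lemma bordered_mulVec (a : ZMod 2) (v : n → ZMod 2) (B : Matrix n n (ZMod 2)) (x : ZMod 2)
    (w : n → ZMod 2) :
    bordered a v B *ᵥ Sum.elim (fun _ => x) w =
      Sum.elim (fun _ => a * x + v ⬝ᵥ w) (x • v + B *ᵥ w) := by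
  ext (i | i) <;> simp [bordered, mulVec, dotProduct, mul_comm]

lemma Nonsing.eq_zero_of_bordered {a : ZMod 2} {v : n → ZMod 2} {B : Matrix n n (ZMod 2)}
    (h : Nonsing (bordered a v B)) {x : ZMod 2} {w : n → ZMod 2}
    (h₁ : a * x + v ⬝ᵥ w = 0) (h₂ : x • v + B *ᵥ w = 0) : x = 0 ∧ w = 0 := by
  have := h (Sum.elim (fun _ => x) w) (by
    rw [bordered_mulVec, h₁, h₂]
    ext (i | i) <;> rfl)
  exact ⟨congrFun this (.inl ()), funext fun i => congrFun this (.inr i)⟩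

lemma nonsing_bordered {a : ZMod 2} {v : n → ZMod 2} {B : Matrix n n (ZMod 2)}
    (h : ∀ x w, a * x + v ⬝ᵥ w = 0 → x • v + B *ᵥ w = 0 → x = 0 ∧ w = 0) :
    Nonsing (bordered a v B) := by
  intro u hu
  have e : u = Sum.elim (fun _ => u (.inl ())) (u ∘ .inr) := by ext (i | i) <;> rfl
  rw [e, bordered_mulVec] at hu
  obtain ⟨h₁, h₂⟩ := h _ _ (congrFun hu (.inl ())) (funext fun i => congrFun hu (.inr i))
  rw [e, h₁, h₂]
  ext (i | i) <;> rfl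

lemma symmCount_bordered_one_le (v : n → ZMod 2) :
    symmCount n (fun B => Nonsing (bordered 1 v B)) ≤ symmCount n Nonsing := by
  refine symmCount_le_of_injective (fun B => B - vecMulVec v v) sub_left_injective ?_ ?_
  · intro B hB
    exact IsSymm.ext fun i j => by simp [hB.apply, vecMulVec_apply, mul_comm]
  · intro B hB w hw
    rw [sub_mulVec, vecMulVec_mulVec] at hw
    refine (hB.eq_zero_of_bordered (x := -(v ⬝ᵥ w)) (by ring) ?_).2
    rw [← hw]
    ext i
    simp [CharTwo.sub_eq_add, mul_comm, add_comm]

lemma symmCount_bordered_zero_zero :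
    symmCount n (fun B => Nonsing (bordered 0 0 B)) = 0 := by
  rw [symmCount, Finset.card_eq_zero, Finset.filter_eq_empty_iff]
  rintro B - ⟨-, hB⟩
  exact one_ne_zero (hB.eq_zero_of_bordered (x := 1) (w := 0) (by simp) (by simp)).1

lemma exists_invertible_mulVec_eq [DecidableEq n] {v e : n → ZMod 2} (hv : v ≠ 0) (he : e ≠ 0) :
    ∃ P Q : Matrix n n (ZMod 2), Q * P = 1 ∧ P * Q = 1 ∧ P *ᵥ v = e := by
  obtain ⟨g, hg⟩ := Submodule.exists_linearEquiv_restrict_eq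
    ((LinearEquiv.toSpanNonzeroSingleton (ZMod 2) _ v hv).symm ≪≫ₗ
      LinearEquiv.toSpanNonzeroSingleton (ZMod 2) _ e he)
  have hgv : g v = e := by
    have := hg ⟨v, Submodule.mem_span_singleton_self v⟩
    rw [← this]
    simp [LinearEquiv.coord_self]
  refine ⟨LinearMap.toMatrix' g, LinearMap.toMatrix' g.symm, ?_, ?_, ?_⟩
  · rw [← LinearMap.toMatrix'_comp]; simp
  · rw [← LinearMap.toMatrix'_comp]; simp
  · rw [LinearMap.toMatrix'_mulVec]; exact hgv

lemma symmCount_bordered_zero_le {v e : n → ZMod 2} (hv : v ≠ 0) (he : e ≠ 0) :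
    symmCount n (fun B => Nonsing (bordered 0 v B)) ≤
      symmCount n (fun B => Nonsing (bordered 0 e B)) := by
  obtain ⟨P, Q, hQP, hPQ, rfl⟩ := exists_invertible_mulVec_eq hv he
  have hPQt : Qᵀ * Pᵀ = 1 := by rw [← transpose_mul, hPQ, transpose_one]
  have hQPt : Pᵀ * Qᵀ = 1 := by rw [← transpose_mul, hQP, transpose_one]
  refine symmCount_le_of_injective (fun B => P * B * Pᵀ) ?_ ?_ ?_
  · refine Function.LeftInverse.injective (g := fun B => Q * B * Qᵀ) fun B => ?_
    calc Q * (P * B * Pᵀ) * Qᵀ = (Q * P) * B * (Pᵀ * Qᵀ) := by simp only [Matrix.mul_assoc]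
      _ = B := by rw [hQP, hQPt, Matrix.one_mul, Matrix.mul_one]
  · intro B hB
    rw [IsSymm, transpose_mul, transpose_mul, transpose_transpose, hB.eq, Matrix.mul_assoc]
  · intro B hB
    refine nonsing_bordered fun x w h₁ h₂ => ?_
    obtain ⟨hx, hw⟩ := hB.eq_zero_of_bordered (x := x) (w := Pᵀ *ᵥ w)
      (by
        rw [mulVec_transpose, dotProduct_comm v, ← dotProduct_mulVec, dotProduct_comm w]
        exact h₁)
      (by
        have := congrArg (Q *ᵥ ·) h₂
        simpa [mulVec_add, mulVec_smul, mulVec_mulVec, ← Matrix.mul_assoc, hQP] using this)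
    refine ⟨hx, ?_⟩
    simpa [mulVec_mulVec, hPQt] using congrArg (Qᵀ *ᵥ ·) hw

lemma symmCount_bordered_single_le :
    symmCount (Unit ⊕ m) (fun B => Nonsing (bordered 0 (Sum.elim 1 0) B)) ≤
      2 * 2 ^ Fintype.card m * symmCount m Nonsing := by
  have h : ∀ b u, symmCount m
      (fun C => Nonsing (bordered 0 (Sum.elim (1 : Unit → ZMod 2) 0) (bordered b u C))) ≤
        symmCount m Nonsing := by
    refine fun b u => symmCount_le_of_injective id Function.injective_id (fun _ h => h) ?_
    intro C hC w hw
    obtain ⟨-, h⟩ := hC.eq_zero_of_bordered (x := -(u ⬝ᵥ w)) (w := Sum.elim (fun _ => 0) w)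
      (by simp) (by
        rw [bordered_mulVec, id] at *
        ext (i | i) <;> simp [hw, CharTwo.add_self_eq_zero])
    exact funext fun i => congrFun h (.inr i)
  rw [symmCount_sum]
  refine (Finset.sum_le_sum fun b _ => Finset.sum_le_sum fun u _ => h b u).trans_eq ?_
  simp [ZMod.card, mul_assoc]

lemma symmCount_le_add_of_forall_le {c : ℕ}
    (hc : ∀ v : n → ZMod 2, v ≠ 0 → symmCount n (fun B => Nonsing (bordered 0 v B)) ≤ c) :
    symmCount (Unit ⊕ n) Nonsing ≤
      2 ^ Fintype.card n * symmCount n Nonsing + (2 ^ Fintype.card n - 1) * c := by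
  have h2 : (Finset.univ : Finset (ZMod 2)) = {1, 0} := by decide
  rw [symmCount_sum, h2, Finset.sum_pair one_ne_zero,
    ← Finset.add_sum_erase _ (fun v => symmCount n (fun B => Nonsing (bordered 0 v B)))
      (Finset.mem_univ 0), symmCount_bordered_zero_zero, zero_add]
  refine add_le_add ?_ ?_
  · refine (Finset.sum_le_sum fun v _ => symmCount_bordered_one_le v).trans_eq ?_
    simp [ZMod.card]
  · refine (Finset.sum_le_card_nsmul _ _ c
      fun v hv => hc v (Finset.ne_of_mem_erase hv)).trans_eq ?_
    rw [Finset.card_erase_of_mem (Finset.mem_univ _), Finset.card_univ, Fintype.card_fun,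
      ZMod.card, smul_eq_mul]

lemma symmCount_nonsing_le_of_equiv (e : n ≃ m) :
    symmCount n Nonsing ≤ symmCount m Nonsing := by
  refine symmCount_le_of_injective (reindex e e) (reindex e e).injective (fun A hA => ?_) ?_
  · exact IsSymm.ext fun i j => by simp [hA.apply]
  · intro A hA
    rw [← isUnit_det_iff_nonsing] at hA ⊢
    rwa [det_reindex_self]

lemma symmCount_true_le_of_equiv (e : n ≃ m) :
    symmCount n (fun _ => True) ≤ symmCount m (fun _ => True) :=
  symmCount_le_of_injective (reindex e e) (reindex e e).injective
    (fun A hA => IsSymm.ext fun i j => by simp [hA.apply]) fun _ h => h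

end

/-- The equivalence splitting off the first index. -/
def finSuccEquivUnitSum (k : ℕ) : Fin (k + 1) ≃ Unit ⊕ Fin k :=
  Fintype.equivOfCardEq (by simp [add_comm])

lemma symmCount_fin_succ_true (k : ℕ) :
    symmCount (Fin (k + 1)) (fun _ => True) =
      2 ^ (k + 1) * symmCount (Fin k) (fun _ => True) := by
  rw [le_antisymm (symmCount_true_le_of_equiv (finSuccEquivUnitSum k))
    (symmCount_true_le_of_equiv (finSuccEquivUnitSum k).symm), symmCount_sum]
  simp [ZMod.card, pow_succ']
  ring

lemma symmCount_fin_one_le :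
    symmCount (Fin 1) Nonsing ≤ symmCount (Fin 0) Nonsing := by
  simpa using (symmCount_nonsing_le_of_equiv (finSuccEquivUnitSum 0)).trans
    (symmCount_le_add_of_forall_le (c := 0) fun v hv => absurd (Subsingleton.elim v 0) hv)

lemma symmCount_fin_add_two_le (k : ℕ) :
    symmCount (Fin (k + 2)) Nonsing ≤ 2 ^ (k + 1) * symmCount (Fin (k + 1)) Nonsing +
      (2 ^ (k + 1) - 1) * (2 ^ (k + 1) * symmCount (Fin k) Nonsing) := by
  let e := finSuccEquivUnitSum k
  have hc : Fintype.card (Unit ⊕ Fin k) = k + 1 := by simp [add_comm]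
  have h := symmCount_le_add_of_forall_le (n := Unit ⊕ Fin k)
    (c := 2 * 2 ^ Fintype.card (Fin k) * symmCount (Fin k) Nonsing) fun v hv =>
      (symmCount_bordered_zero_le hv (e := Sum.elim 1 0) fun h => by
        simpa using congrFun h (.inl ())).trans symmCount_bordered_single_le
  rw [hc, Fintype.card_fin, ← pow_succ'] at h
  refine (symmCount_nonsing_le_of_equiv ((finSuccEquivUnitSum (k + 1)).trans
    ((Equiv.refl Unit).sumCongr e))).trans (h.trans ?_)
  gcongr
  exact symmCount_nonsing_le_of_equiv e.symm

lemma symmCount_fin_zero_true : symmCount (Fin 0) (fun _ => True) = 1 := by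
  rw [symmCount, Finset.card_eq_one]
  exact ⟨0, Finset.eq_singleton_iff_unique_mem.2
    ⟨by simp, fun A _ => Subsingleton.elim A 0⟩⟩

lemma symmCount_nonsing_bound (k : ℕ) :
    128 * symmCount (Fin (k + 3)) Nonsing ≤ 63 * symmCount (Fin (k + 3)) (fun _ => True) := by
  have h0 : symmCount (Fin 0) Nonsing ≤ 1 := by
    rw [← symmCount_fin_zero_true]
    exact symmCount_le_of_injective id Function.injective_id (fun _ h => h) fun _ _ => trivial
  have h1 := symmCount_fin_one_le
  have h2 : symmCount (Fin 2) Nonsing ≤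
      2 * symmCount (Fin 1) Nonsing + 1 * (2 * symmCount (Fin 0) Nonsing) :=
    symmCount_fin_add_two_le 0
  have h3 : symmCount (Fin 3) Nonsing ≤
      4 * symmCount (Fin 2) Nonsing + 3 * (4 * symmCount (Fin 1) Nonsing) :=
    symmCount_fin_add_two_le 1
  have t0 := symmCount_fin_zero_true
  have t1 : symmCount (Fin 1) (fun _ => True) = 2 * symmCount (Fin 0) (fun _ => True) :=
    symmCount_fin_succ_true 0
  have t2 : symmCount (Fin 2) (fun _ => True) = 4 * symmCount (Fin 1) (fun _ => True) :=
    symmCount_fin_succ_true 1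
  have t3 : symmCount (Fin 3) (fun _ => True) = 8 * symmCount (Fin 2) (fun _ => True) :=
    symmCount_fin_succ_true 2
  induction k using Nat.twoStepInduction with
  | zero =>
    change 128 * symmCount (Fin 3) Nonsing ≤ 63 * symmCount (Fin 3) (fun _ => True)
    omega
  | one =>
    have h4 : symmCount (Fin 4) Nonsing ≤
        8 * symmCount (Fin 3) Nonsing + 7 * (8 * symmCount (Fin 2) Nonsing) :=
      symmCount_fin_add_two_le 2
    have t4 : symmCount (Fin 4) (fun _ => True) = 16 * symmCount (Fin 3) (fun _ => True) :=
      symmCount_fin_succ_true 3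
    change 128 * symmCount (Fin 4) Nonsing ≤ 63 * symmCount (Fin 4) (fun _ => True)
    omega
  | more k ih₁ ih₂ =>
    have h := symmCount_fin_add_two_le (k + 3)
    have t := symmCount_fin_succ_true (k + 3)
    have t' := symmCount_fin_succ_true (k + 4)
    simp only [add_assoc, Nat.reduceAdd] at *
    rw [t']
    calc _ ≤ 128 * (2 ^ (k + 4) * symmCount (Fin (k + 4)) Nonsing +
          2 ^ (k + 4) * (2 ^ (k + 4) * symmCount (Fin (k + 3)) Nonsing)) := by
            refine Nat.mul_le_mul_left _ (h.trans ?_)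
            gcongr
            exact Nat.sub_le _ _
      _ = 2 ^ (k + 4) * (128 * symmCount (Fin (k + 4)) Nonsing) +
          2 ^ (k + 4) * 2 ^ (k + 4) * (128 * symmCount (Fin (k + 3)) Nonsing) := by ring
      _ ≤ 2 ^ (k + 4) * (63 * symmCount (Fin (k + 4)) fun _ => True) +
          2 ^ (k + 4) * 2 ^ (k + 4) * (63 * symmCount (Fin (k + 3)) fun _ => True) := by gcongr
      _ = _ := by rw [t]; ring

theorem statement18 (k : ℕ) (hk : 4 ≤ k) :
    ((Finset.univ.filter fun A : Matrix (Fin k) (Fin k) (ZMod 2) =>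
        A = Aᵀ ∧ IsUnit A.det).card : ℝ) /
      ((Finset.univ.filter fun A : Matrix (Fin k) (Fin k) (ZMod 2) =>
        A = Aᵀ).card : ℝ) ≤ 1/2 - (2:ℝ) ^ (-7 : ℤ) := by
  obtain ⟨j, rfl⟩ := Nat.exists_eq_add_of_le' (show 3 ≤ k by omega)
  have h := symmCount_nonsing_bound j
  have e₁ : (Finset.univ.filter fun A : Matrix (Fin (j + 3)) (Fin (j + 3)) (ZMod 2) =>
      A = Aᵀ ∧ IsUnit A.det).card = symmCount (Fin (j + 3)) Nonsing := by
    simp only [symmCount, IsSymm, isUnit_det_iff_nonsing, @eq_comm _ _ (transpose _)]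
    congr!
  have e₂ : (Finset.univ.filter fun A : Matrix (Fin (j + 3)) (Fin (j + 3)) (ZMod 2) =>
      A = Aᵀ).card = symmCount (Fin (j + 3)) (fun _ => True) := by
    simp only [symmCount, IsSymm, and_true, @eq_comm _ _ (transpose _)]
    congr!
  have hpos : 0 < symmCount (Fin (j + 3)) (fun _ => True) := by
    rw [← e₂, Finset.card_pos]
    exact ⟨0, by simp⟩
  rw [e₁, e₂, div_le_iff₀ (Nat.cast_pos.2 hpos)]
  rify at h
  norm_num
  linarith

end
end
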